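/- arXiv:0812.1993 — 2 statements merged into one kernel-verified Lean document; each statement's English description precedes it below -/
import Mathlib

section
/- Let n ≥ 2 and let η := diag(-1,1,…,1) ∈ M_{n+1}(ℝ) define the Lorentzian form of signature (1,n) on ℝ^{n+1}, with 𝔰𝔬(1,n) := {M ∈ M_{n+1}(ℝ) : Mᵀη + ηM = 0}. If 𝔥 ⊆ 𝔰𝔬(1,n) is a Lie subalgebra acting irreducibly on ℝ^{n+1} (i.e., the only subspaces of ℝ^{n+1} invariant under every element of 𝔥 are 0 and ℝ^{n+1}), then 𝔥 = 𝔰𝔬(1,n). -/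
open Matrix

/-- A symmetric bilinear form that is negative on some vector and positive definite on the
orthogonal complement of that vector. -/
structure IsLorentzian {V : Type*} [AddCommGroup V] [Module ℝ V]
    (β : LinearMap.BilinForm ℝ V) : Prop where
  symm : ∀ x y, β x y = β y x
  exists_timelike : ∃ e, β e e < 0 ∧ ∀ x, β x e = 0 → x ≠ 0 → 0 < β x x

/-- The bilinear form changes sign when `X` is moved across it. -/
def IsSkew {V : Type*} [AddCommGroup V] [Module ℝ V]
    (β : LinearMap.BilinForm ℝ V) (X : Module.End ℝ V) : Prop :=
  ∀ x y, β (X x) y = -β x (X y)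

/-- The endomorphism `x ↦ β b x • a - β a x • b`, bilinear in `a` and `b`. -/
noncomputable def wedge {V : Type*} [AddCommGroup V] [Module ℝ V]
    (β : LinearMap.BilinForm ℝ V) : V →ₗ[ℝ] V →ₗ[ℝ] Module.End ℝ V :=
  LinearMap.mk₂ ℝ (fun a b => (β b).smulRight a - (β a).smulRight b)
    (fun a a' b => by ext x; simp; module) (fun c a b => by ext x; simp; module)
    (fun a b b' => by ext x; simp; module) (fun c a b => by ext x; simp; module)

section Lorentz

attribute [local instance] LieRing.ofAssociativeRing

variable {V : Type*} [AddCommGroup V] [Module ℝ V] {β : LinearMap.BilinForm ℝ V}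

theorem wedge_apply (a b x : V) : wedge β a b x = β b x • a - β a x • b := rfl

theorem wedge_self (a : V) : wedge β a a = 0 := by
  ext x; simp [wedge_apply]

theorem wedge_swap (a b : V) : wedge β a b = -wedge β b a := by
  ext x; simp [wedge_apply]

theorem IsSkew.lie_wedge {X : Module.End ℝ V} (hX : IsSkew β X) (a b : V) :
    ⁅X, wedge β a b⁆ = wedge β (X a) b + wedge β a (X b) := by
  ext x
  simp only [LieRing.of_associative_ring_bracket, LinearMap.sub_apply, Module.End.mul_apply,
    LinearMap.add_apply, wedge_apply, map_sub, map_smul, hX a x, hX b x]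
  module

namespace IsLorentzian

theorem isSkew_wedge (hβ : IsLorentzian β) (a b : V) : IsSkew β (wedge β a b) := by
  intro x y
  simp only [wedge_apply, map_sub, map_smul, LinearMap.sub_apply, LinearMap.smul_apply,
    smul_eq_mul, hβ.symm x a, hβ.symm x b]
  ring

theorem apply_self_eq_zero (hβ : IsLorentzian β) {X : Module.End ℝ V} (hX : IsSkew β X)
    (x : V) : β x (X x) = 0 := by
  have h1 := hX x x
  rw [hβ.symm (X x) x] at h1
  linarith

theorem exists_sub_smul_orthogonal (hβ : IsLorentzian β) {ξ : V} (h0 : ξ ≠ 0)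
    (hξ : β ξ ξ = 0) {y : V} (hy : β ξ y = 0) :
    ∃ c : ℝ, β (y - c • ξ) (y - c • ξ) = β y y ∧ (y ≠ c • ξ → 0 < β y y) := by
  obtain ⟨e, -, hpos⟩ := hβ.exists_timelike
  have hne : β ξ e ≠ 0 := fun h => (hpos ξ h h0).ne' hξ
  have hval : β (y - (β y e / β ξ e) • ξ) (y - (β y e / β ξ e) • ξ) = β y y := by
    simp [hξ, hy, hβ.symm y ξ]
  refine ⟨β y e / β ξ e, hval, fun h => ?_⟩
  rw [← hval]
  refine hpos _ ?_ (sub_ne_zero.mpr h)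
  simp only [map_sub, map_smul, LinearMap.sub_apply, LinearMap.smul_apply, smul_eq_mul]
  field_simp
  ring

/-- Orthogonal null vectors are proportional. -/
theorem eq_smul_of_null (hβ : IsLorentzian β) {ξ : V} (h0 : ξ ≠ 0) (hξ : β ξ ξ = 0) {y : V}
    (hy : β ξ y = 0) (hyy : β y y = 0) : ∃ c : ℝ, y = c • ξ := by
  obtain ⟨c, -, hc⟩ := hβ.exists_sub_smul_orthogonal h0 hξ hy
  by_contra! h
  exact (hc (h c)).ne' hyy

/-- The orthogonal complement of a hyperbolic pair is positive definite. -/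
theorem pos_of_orthogonal_pair (hβ : IsLorentzian β) {ξ ξ' : V} (hξ : β ξ ξ = 0)
    (hp : β ξ ξ' = 1) {y : V} (hy : β ξ y = 0) (hy' : β ξ' y = 0) (hne : y ≠ 0) :
    0 < β y y := by
  have h0 : ξ ≠ 0 := by rintro rfl; simp at hp
  obtain ⟨c, -, hc⟩ := hβ.exists_sub_smul_orthogonal h0 hξ hy
  refine hc fun h => hne ?_
  rw [h, map_smul, hβ.symm ξ' ξ, hp] at hy'
  have : c = 0 := by simpa using hy'
  rw [h, this, zero_smul]

/-- A skew endomorphism with a non-imaginary complex eigenvalue has a nonzero real eigenvalue. -/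
theorem exists_real_eigenvector (hβ : IsLorentzian β) {X : Module.End ℝ V} (hX : IsSkew β X)
    {a b : ℝ} {v : V} (hv : v ≠ 0) (ha : a ≠ 0)
    (h : X (X v) - (2 * a) • X v + (a ^ 2 + b ^ 2) • v = 0) :
    ∃ c : ℝ, c ≠ 0 ∧ X v = c • v := by
  have hvX := hβ.apply_self_eq_zero hX v
  have hXX := hβ.apply_self_eq_zero hX (X v)
  have h1 := congrArg (β (X v)) h
  have h2 := congrArg (β v) h
  have h3 := hX v (X v)
  have hab : a ^ 2 + b ^ 2 ≠ 0 := by positivity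
  simp only [map_add, map_sub, map_smul, smul_eq_mul, map_zero, hXX, hvX, hβ.symm (X v) v] at h1 h2
  have h4 : β (X v) (X v) = 0 := by
    have : 2 * a * β (X v) (X v) = 0 := by linarith
    simpa [ha] using this
  have h5 : β v v = 0 := by
    have : (a ^ 2 + b ^ 2) * β v v = 0 := by linarith
    exact (mul_eq_zero.mp this).resolve_left hab
  obtain ⟨c, hc⟩ := hβ.eq_smul_of_null hv h5 hvX h4
  refine ⟨c, ?_, hc⟩
  rintro rfl
  rw [zero_smul] at hc
  rw [hc] at h
  simp [hab, hv] at h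

theorem exists_opposite_eigenvector [FiniteDimensional ℝ V] (hβ : IsLorentzian β)
    {X : Module.End ℝ V} (hX : IsSkew β X) {ξ : V} (h0 : ξ ≠ 0) (hξ : X ξ = ξ) :
    β ξ ξ = 0 ∧ ∃ ξ', X ξ' = -ξ' ∧ β ξ' ξ' = 0 ∧ β ξ ξ' = 1 := by
  have hnull : β ξ ξ = 0 := by simpa [hξ] using hβ.apply_self_eq_zero hX ξ
  refine ⟨hnull, ?_⟩
  obtain ⟨e, -, hpos⟩ := hβ.exists_timelike
  have hne : β ξ e ≠ 0 := fun h => (hpos ξ h h0).ne' hnull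
  have hsurj : ¬ Function.Surjective (X + 1 : Module.End ℝ V) := by
    intro hs
    obtain ⟨y, rfl⟩ := hs e
    apply hne
    rw [LinearMap.add_apply, Module.End.one_apply, map_add]
    have := hX ξ y
    rw [hξ] at this
    linarith
  rw [← LinearMap.injective_iff_surjective, ← LinearMap.ker_eq_bot] at hsurj
  obtain ⟨y, hy, hy0⟩ := Submodule.exists_mem_ne_zero_of_ne_bot hsurj
  have hXy : X y = -y := by
    rw [LinearMap.mem_ker, LinearMap.add_apply, Module.End.one_apply] at hy
    exact eq_neg_of_add_eq_zero_left hy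
  have hyy : β y y = 0 := by simpa [hXy] using hβ.apply_self_eq_zero hX y
  have hp : β ξ y ≠ 0 := by
    intro hp
    obtain ⟨c, rfl⟩ := hβ.eq_smul_of_null h0 hnull hp hyy
    rw [map_smul, hξ, eq_neg_iff_add_eq_zero, ← two_smul ℝ] at hXy
    simp_all
  exact ⟨(β ξ y)⁻¹ • y, by simp [hXy], by simp [hyy], by simp [hp]⟩

end IsLorentzian

theorem exists_complex_root_vector [FiniteDimensional ℝ V] (X : Module.End ℝ V) {μ : ℂ}
    (h : Module.End.HasEigenvalue (X.baseChange ℂ) μ) :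
    ∃ v ≠ 0, X (X v) - (2 * μ.re) • X v + (μ.re ^ 2 + μ.im ^ 2) • v = 0 := by
  set Q : Module.End ℝ V := X * X - (2 * μ.re) • X + (μ.re ^ 2 + μ.im ^ 2) • 1 with hQ
  obtain ⟨w, hw⟩ := h.exists_hasEigenvector
  have hQw : Q.baseChange ℂ w = 0 := by
    have hQC : Q.baseChange ℂ = X.baseChange ℂ * X.baseChange ℂ -
        (2 * μ.re : ℂ) • X.baseChange ℂ + (μ.re ^ 2 + μ.im ^ 2 : ℂ) • 1 := by
      ext v
      simp [hQ]
      simp only [← algebraMap_smul ℂ (_ : ℝ) (_ : TensorProduct ℝ ℂ V)]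
      simp
    rw [hQC]
    simp [hw.apply_eq_smul]
    have hμ : μ = μ.re + μ.im * Complex.I := (Complex.re_add_im μ).symm
    have hc : μ * μ - 2 * μ.re * μ + (μ.re ^ 2 + μ.im ^ 2 : ℂ) = 0 := by
      linear_combination (μ - μ.re + μ.im * Complex.I) * hμ + (μ.im : ℂ) ^ 2 * Complex.I_sq
    rw [smul_smul, smul_smul, ← sub_smul, ← add_smul, hc, zero_smul]
  have hdet : Q.det = 0 := by
    have h1 : (Q.baseChange ℂ).det = 0 := LinearMap.det_eq_zero_iff_ker_ne_bot.mpr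
      (Submodule.ne_bot_iff _ |>.mpr ⟨w, hQw, hw.2⟩)
    rw [LinearMap.det_baseChange] at h1
    simpa using h1
  rw [LinearMap.det_eq_zero_iff_ker_ne_bot] at hdet
  obtain ⟨v, hv, hv0⟩ := Submodule.exists_mem_ne_zero_of_ne_bot hdet
  exact ⟨v, hv0, by simpa [hQ] using hv⟩

theorem exists_quadratic_root [FiniteDimensional ℝ V] [Nontrivial V] (X : Module.End ℝ V) :
    ∃ a b : ℝ, ∃ v ≠ 0, X (X v) - (2 * a) • X v + (a ^ 2 + b ^ 2) • v = 0 := by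
  obtain ⟨μ, hμ⟩ := Module.End.exists_eigenvalue (X.baseChange ℂ)
  exact ⟨μ.re, μ.im, exists_complex_root_vector X hμ⟩

theorem Module.End.HasEigenvalue.sqrt_or_neg {K W : Type*} [Field K] [AddCommGroup W] [Module K W]
    {T : Module.End K W} {μ : K} (h : (T * T).HasEigenvalue (μ * μ)) :
    T.HasEigenvalue μ ∨ T.HasEigenvalue (-μ) := by
  obtain ⟨w, hw⟩ := h.exists_hasEigenvector
  by_cases h0 : T w + μ • w = 0
  · exact Or.inr (Module.End.hasEigenvalue_of_hasEigenvector (x := w)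
      ⟨Module.End.mem_eigenspace_iff.mpr (by rw [neg_smul]; exact eq_neg_of_add_eq_zero_left h0),
        hw.2⟩)
  · refine Or.inl (Module.End.hasEigenvalue_of_hasEigenvector (x := T w + μ • w)
      ⟨Module.End.mem_eigenspace_iff.mpr ?_, h0⟩)
    have := hw.apply_eq_smul
    rw [Module.End.mul_apply] at this
    rw [map_add, map_smul, this]
    module

theorem IsLorentzian.trace_sq_nonpos [FiniteDimensional ℝ V] (hβ : IsLorentzian β)
    {X : Module.End ℝ V} (hX : IsSkew β X)
    (hreal : ∀ (c : ℝ) (v : V), v ≠ 0 → X v = c • v → c = 0) :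
    LinearMap.trace ℝ V (X * X) ≤ 0 ∧ (LinearMap.trace ℝ V (X * X) = 0 → IsNilpotent X) := by
  set Y : Module.End ℂ (TensorProduct ℝ ℂ V) := (X * X).baseChange ℂ with hY
  have himag : ∀ μ : ℂ, Module.End.HasEigenvalue (X.baseChange ℂ) μ → μ.re = 0 := by
    intro μ hμ
    obtain ⟨v, hv, h⟩ := exists_complex_root_vector X hμ
    by_contra hre
    obtain ⟨c, hc, hcv⟩ := hβ.exists_real_eigenvector hX hv hre h
    exact hc (hreal c v hv hcv)
  have hroot : ∀ ν ∈ Y.charpoly.roots, ν.re ≤ 0 ∧ ν.im = 0 := by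
    intro ν hν
    obtain ⟨μ, rfl⟩ := IsAlgClosed.exists_eq_mul_self ν
    have h1 : Module.End.HasEigenvalue Y (μ * μ) :=
      (Module.End.hasEigenvalue_iff_isRoot_charpoly Y _).mpr (Polynomial.isRoot_of_mem_roots hν)
    rw [hY, LinearMap.baseChange_mul] at h1
    have h2 : μ.re = 0 := by
      rcases h1.sqrt_or_neg with h | h
      · exact himag _ h
      · simpa using himag _ h
    simp [h2]
    nlinarith
  have htr : ((LinearMap.trace ℝ V (X * X) : ℝ) : ℂ) = Y.charpoly.roots.sum := by
    rw [← Module.End.trace_eq_sum_roots_charpoly_of_splits (IsAlgClosed.splits _), hY,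
      LinearMap.trace_baseChange]
    rfl
  have hre : -LinearMap.trace ℝ V (X * X) = (Y.charpoly.roots.map fun ν => -ν.re).sum := by
    have := congrArg (-Complex.reAddGroupHom) htr
    rw [map_multiset_sum] at this
    exact this
  have hle : ∀ t ∈ Y.charpoly.roots.map fun ν => -ν.re, 0 ≤ t := by
    simp only [Multiset.mem_map]
    rintro _ ⟨ν, hν, rfl⟩
    exact neg_nonneg.mpr (hroot ν hν).1
  refine ⟨neg_nonneg.mp (hre ▸ Multiset.sum_nonneg hle), fun h0 => ?_⟩
  have hzero : ∀ ν ∈ Y.charpoly.roots, ν = 0 := by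
    intro ν hν
    refine Complex.ext ?_ (hroot ν hν).2
    have := Multiset.all_zero_of_le_zero_le_of_sum_eq_zero hle (by rw [← hre, h0, neg_zero]) _
      (Multiset.mem_map_of_mem _ hν)
    simpa using this
  have hpow : Y.charpoly = Polynomial.X ^ Multiset.card Y.charpoly.roots := by
    conv_lhs => rw [(IsAlgClosed.splits Y.charpoly).eq_prod_roots_of_monic Y.charpoly_monic,
      Multiset.eq_replicate_card.mpr hzero]
    simp
  have hpow' : (X * X).charpoly = Polynomial.X ^ Multiset.card Y.charpoly.roots :=
    Polynomial.map_injective _ (algebraMap ℝ ℂ).injective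
      (by rw [← LinearMap.charpoly_baseChange, ← hY, Polynomial.map_pow, Polynomial.map_X, ← hpow])
  have hCH := (X * X).aeval_self_charpoly
  rw [hpow', map_pow, Polynomial.aeval_X, ← pow_two, ← pow_mul] at hCH
  exact ⟨_, hCH⟩

/-- A double bracket with a nonzero element of one horospherical subalgebra carries elements of the
opposite one into it. -/
theorem wedge_mem_of_wedge_mem (hβ : IsLorentzian β) {L : LieSubalgebra ℝ (Module.End ℝ V)}
    {ξ ξ' : V} (hξ : β ξ ξ = 0) (hp : β ξ ξ' = 1) {v v' : V} (hv0 : v ≠ 0)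
    (hv : β ξ v = 0) (hv' : β ξ' v = 0) (hw : β ξ v' = 0)
    (hvL : wedge β v ξ ∈ L) (hwL : wedge β v' ξ' ∈ L) : wedge β v' ξ ∈ L := by
  have hpos := hβ.pos_of_orthogonal_pair hξ hp hv hv' hv0
  have hK := L.lie_mem (L.lie_mem hvL hwL) hvL
  have hp' : β ξ' ξ = 1 := by rw [hβ.symm, hp]
  have key : ⁅⁅wedge β v ξ, wedge β v' ξ'⁆, wedge β v ξ⁆ =
      β v v • wedge β v' ξ - (2 * β v v') • wedge β v ξ := by
    rw [(hβ.isSkew_wedge v ξ).lie_wedge]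
    simp only [wedge_apply, hw, hp, hβ.symm v ξ', hv', zero_smul, zero_sub, one_smul, sub_zero,
      map_neg, map_smul, LinearMap.neg_apply, LinearMap.smul_apply, add_lie, neg_lie, smul_lie,
      (hβ.isSkew_wedge _ _).lie_wedge, hp', hv, hξ, hβ.symm v' ξ, hβ.symm v ξ,
      hβ.symm v' v, map_zero, LinearMap.zero_apply, add_zero, zero_add, map_sub,
      LinearMap.sub_apply]
    module
  rw [key] at hK
  have h1 := L.smul_mem (β v v)⁻¹ (L.add_mem hK (L.smul_mem (2 * β v v') hvL))
  rwa [sub_add_cancel, inv_smul_smul₀ hpos.ne'] at h1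

theorem exists_wedge_add_mem (hβ : IsLorentzian β) {L : LieSubalgebra ℝ (Module.End ℝ V)}
    (hL : ∀ Y ∈ L, IsSkew β Y) {ξ ξ' : V} (hξ : β ξ ξ = 0) (hξ' : β ξ' ξ' = 0)
    (hp : β ξ ξ' = 1) (hH : wedge β ξ ξ' ∈ L) {Y : Module.End ℝ V} (hY : Y ∈ L) :
    ∃ (a : ℝ) (u : V), Y ξ = a • ξ + u ∧ β ξ u = 0 ∧ β ξ' u = 0 ∧ wedge β u ξ' ∈ L := by
  have hp' : β ξ' ξ = 1 := by rw [hβ.symm, hp]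
  have hs := hL Y hY
  have h1 : β ξ (Y ξ) = 0 := hβ.apply_self_eq_zero hs ξ
  have h2 : β ξ' (Y ξ') = 0 := hβ.apply_self_eq_zero hs ξ'
  have h3 : β ξ (Y ξ') = -β ξ' (Y ξ) := by rw [hβ.symm ξ', hs, neg_neg]
  have hA := L.lie_mem hY hH
  have hB := L.lie_mem hH hA
  refine ⟨β ξ' (Y ξ), Y ξ - β ξ' (Y ξ) • ξ, by abel, by simp [h1, hξ], by simp [hp'], ?_⟩
  have key : wedge β (Y ξ - β ξ' (Y ξ) • ξ) ξ' = (2⁻¹ : ℝ) • (⁅Y, wedge β ξ ξ'⁆ -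
      ⁅wedge β ξ ξ', ⁅Y, wedge β ξ ξ'⁆⁆) := by
    simp only [hs.lie_wedge, lie_add, (hβ.isSkew_wedge _ _).lie_wedge, wedge_apply, h1, h2, h3,
      hξ, hξ', hp, hp', map_sub, map_smul, LinearMap.sub_apply, LinearMap.smul_apply, zero_smul,
      one_smul, zero_sub, sub_zero, map_neg]
    module
  rw [key]
  exact L.smul_mem _ (L.sub_mem hA hB)

theorem wedge_mem_of_hyperbolic_pair (hβ : IsLorentzian β)
    {L : LieSubalgebra ℝ (Module.End ℝ V)} (hL : ∀ Y ∈ L, IsSkew β Y)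
    (hirr : ∀ W : Submodule ℝ V, (∀ Y ∈ L, ∀ x ∈ W, Y x ∈ W) → W = ⊥ ∨ W = ⊤)
    {ξ ξ' : V} (hξ : β ξ ξ = 0) (hξ' : β ξ' ξ' = 0) (hp : β ξ ξ' = 1) {v v' : V}
    (hv0 : v ≠ 0) (hv0' : v' ≠ 0) (hv : β ξ v = 0) (hv' : β ξ' v = 0) (hw : β ξ v' = 0)
    (hw' : β ξ' v' = 0) (hvL : wedge β v ξ ∈ L) (hwL : wedge β v' ξ' ∈ L) (x y : V) :
    wedge β x y ∈ L := by
  have hp' : β ξ' ξ = 1 := by rw [hβ.symm, hp]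
  have hH : wedge β ξ ξ' ∈ L := by
    have h1 := wedge_mem_of_wedge_mem hβ hξ hp hv0 hv hv' hw hvL hwL
    have h2 := L.lie_mem h1 hwL
    have key : ⁅wedge β v' ξ, wedge β v' ξ'⁆ = -(β v' v' • wedge β ξ ξ') := by
      simp only [(hβ.isSkew_wedge _ _).lie_wedge, wedge_apply, hw, hp, hβ.symm v' ξ', hw',
        zero_smul, zero_sub, one_smul, sub_zero, wedge_self, add_zero, map_neg, map_smul,
        LinearMap.neg_apply, LinearMap.smul_apply]
    rw [key, neg_mem_iff] at h2
    have h3 := L.smul_mem (β v' v')⁻¹ h2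
    rwa [inv_smul_smul₀ (hβ.pos_of_orthogonal_pair hξ hp hw hw' hv0').ne'] at h3
  have hH' : wedge β ξ' ξ ∈ L := by rw [wedge_swap]; exact L.neg_mem hH
  let U : Submodule ℝ V :=
    L.toSubmodule.comap ((wedge β).flip ξ) ⊓ L.toSubmodule.comap ((wedge β).flip ξ')
  have hU : ∀ x, x ∈ U ↔ wedge β x ξ ∈ L ∧ wedge β x ξ' ∈ L := fun x => Iff.rfl
  have hξU : ξ ∈ U := by simp [hU, wedge_self, hH]
  have hξU' : ξ' ∈ U := by simp [hU, wedge_self, hH']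
  have hYξ : ∀ Y ∈ L, Y ξ ∈ U := by
    intro Y hY
    obtain ⟨a, u, h1, h2, h3, h4⟩ := exists_wedge_add_mem hβ hL hξ hξ' hp hH hY
    rw [h1]
    exact U.add_mem (U.smul_mem _ hξU)
      ((hU u).mpr ⟨wedge_mem_of_wedge_mem hβ hξ hp hv0 hv hv' h2 hvL h4, h4⟩)
  have hYξ' : ∀ Y ∈ L, Y ξ' ∈ U := by
    intro Y hY
    obtain ⟨a, u, h1, h2, h3, h4⟩ := exists_wedge_add_mem hβ hL hξ' hξ hp' hH' hY
    rw [h1]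
    exact U.add_mem (U.smul_mem _ hξU')
      ((hU u).mpr ⟨h4, wedge_mem_of_wedge_mem hβ hξ' hp' hv0' hw' hw h2 hwL h4⟩)
  have hUU : ∀ x ∈ U, ∀ u ∈ U, wedge β x u ∈ L := by
    intro x hx u hu
    obtain ⟨hx1, hx2⟩ := (hU x).mp hx
    obtain ⟨hu1, hu2⟩ := (hU u).mp hu
    have h1 := L.lie_mem hx1 hu2
    have key : wedge β x u = β ξ u • wedge β x ξ' - β x u • wedge β ξ ξ' +
        β x ξ' • wedge β ξ u - ⁅wedge β x ξ, wedge β u ξ'⁆ := by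
      simp only [(hβ.isSkew_wedge _ _).lie_wedge, wedge_apply, hp, one_smul, map_sub, map_smul,
        LinearMap.sub_apply, LinearMap.smul_apply, wedge_swap x u, wedge_swap ξ u]
      module
    rw [key]
    refine L.sub_mem (L.add_mem (L.sub_mem (L.smul_mem _ hx2) (L.smul_mem _ hH))
      (L.smul_mem _ ?_)) h1
    rw [wedge_swap]
    exact L.neg_mem hu1
  have htop : U = ⊤ := by
    refine (hirr U fun Y hY x hx => (hU _).mpr ⟨?_, ?_⟩).resolve_left ?_
    · rw [eq_sub_of_add_eq ((hL Y hY).lie_wedge x ξ).symm]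
      exact L.sub_mem (L.lie_mem hY ((hU x).mp hx).1) (hUU x hx _ (hYξ Y hY))
    · rw [eq_sub_of_add_eq ((hL Y hY).lie_wedge x ξ').symm]
      exact L.sub_mem (L.lie_mem hY ((hU x).mp hx).2) (hUU x hx _ (hYξ' Y hY))
    · intro hbot
      rw [hbot, Submodule.mem_bot] at hξU
      simp [hξU] at hp
  exact hUU x (htop ▸ Submodule.mem_top) y (htop ▸ Submodule.mem_top)

/-- The trace form is nondegenerate on skew endomorphisms killing a hyperbolic pair. -/
theorem IsLorentzian.eq_zero_of_trace_sq_eq_zero [FiniteDimensional ℝ V] (hβ : IsLorentzian β)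
    {F : Module.End ℝ V} (hF : IsSkew β F) {ξ ξ' : V} (hξ : β ξ ξ = 0) (hp : β ξ ξ' = 1)
    (hFξ : F ξ = 0) (hFξ' : F ξ' = 0) (htr : LinearMap.trace ℝ V (F * F) = 0) : F = 0 := by
  have horth : ∀ x, F x ≠ 0 → 0 < β (F x) (F x) := by
    intro x hx
    have h1 := hF ξ x
    have h2 := hF ξ' x
    simp only [hFξ, hFξ', map_zero, LinearMap.zero_apply, zero_eq_neg] at h1 h2
    exact hβ.pos_of_orthogonal_pair hξ hp h1 h2 hx
  have hreal : ∀ (c : ℝ) (v : V), v ≠ 0 → F v = c • v → c = 0 := by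
    intro c v hv hc
    by_contra hc0
    have h1 := horth v (by simp [hc, hc0, hv])
    have h2 := hβ.apply_self_eq_zero hF v
    simp only [hc, map_smul, LinearMap.smul_apply, smul_eq_mul] at h1 h2
    rw [h2] at h1
    simp at h1
  obtain ⟨k, hk⟩ := (hβ.trace_sq_nonpos hF hreal).2 htr
  induction k with
  | zero =>
    ext x
    simpa using congrArg (fun T : Module.End ℝ V => F (T x)) hk
  | succ k ih =>
    rcases k with _ | k
    · simpa using hk
    refine ih (LinearMap.ext fun x => ?_)
    by_contra hne
    have h3 := hF ((F ^ k) x) (F ((F ^ k) x))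
    have h4 : F (F ((F ^ k) x)) = 0 := by
      have := LinearMap.congr_fun hk x
      rwa [pow_succ', pow_succ'] at this
    rw [h4, map_zero, neg_zero] at h3
    rw [pow_succ'] at hne
    exact (horth _ hne).ne' h3

/-- A skew endomorphism in the generalized `-1 + i b` eigenspace of `ad X` lies in the
corresponding horospherical subalgebra. -/
theorem IsLorentzian.eq_wedge_of_lie_lie [FiniteDimensional ℝ V] (hβ : IsLorentzian β)
    {X Z : Module.End ℝ V} (hX : IsSkew β X) (hZ : IsSkew β Z) {ξ ξ' : V} (hξ : β ξ ξ = 0)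
    (hξ' : β ξ' ξ' = 0) (hp : β ξ ξ' = 1) (hXξ : X ξ = ξ) (hXξ' : X ξ' = -ξ') {b : ℝ}
    (h : ⁅X, ⁅X, Z⁆⁆ + (2 : ℝ) • ⁅X, Z⁆ + (1 + b ^ 2) • Z = 0) :
    Z = wedge β (Z ξ) ξ' ∧ β ξ (Z ξ) = 0 ∧ β ξ' (Z ξ) = 0 := by
  have h0' : ξ' ≠ 0 := by rintro rfl; simp at hp
  have hp' : β ξ' ξ = 1 := by rw [hβ.symm, hp]
  simp only [Ring.lie_def] at h
  have hZξ' : Z ξ' = 0 := by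
    set y := Z ξ' with hy
    have h1 : X (X y) + (4 : ℝ) • X y + (4 + b ^ 2) • y = 0 := by
      have := LinearMap.congr_fun h ξ'
      simp only [LinearMap.add_apply, LinearMap.sub_apply, LinearMap.smul_apply,
        Module.End.mul_apply, hXξ', map_neg, map_sub, LinearMap.zero_apply, ← hy] at this
      rw [← this]
      module
    have hyξ' : β ξ' y = 0 := hβ.apply_self_eq_zero hZ ξ'
    have hXyξ' : β ξ' (X y) = 0 := by
      have := hX ξ' y
      simp only [hXξ', map_neg, LinearMap.neg_apply, hyξ'] at this
      linarith
    have hXy : β (X y) (X y) = 0 := by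
      have h2 := congrArg (β (X y)) h1
      simp only [map_add, map_smul, smul_eq_mul, map_zero, hβ.apply_self_eq_zero hX,
        hβ.symm (X y) y] at h2
      linarith
    obtain ⟨c, hc⟩ := hβ.eq_smul_of_null h0' hξ' hXyξ' hXy
    have hy' : y = ((-3 * c) / (4 + b ^ 2)) • ξ' := by
      rw [hc, map_smul, hXξ'] at h1
      have h4 : (4 + b ^ 2) ≠ 0 := by positivity
      rw [div_eq_inv_mul, mul_smul, eq_inv_smul_iff₀ h4, ← sub_eq_zero, ← h1]
      module
    generalize (-3 * c) / (4 + b ^ 2) = d at hy'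
    rw [hy', map_smul, hXξ', map_smul, map_neg, hXξ'] at h1
    have h5 : (1 + b ^ 2) • d • ξ' = 0 := by rw [← h1]; module
    rw [hy']
    exact (smul_eq_zero.mp h5).resolve_left (by positivity)
  have hv1 : β ξ (Z ξ) = 0 := hβ.apply_self_eq_zero hZ ξ
  have hv2 : β ξ' (Z ξ) = 0 := by
    have := hZ ξ' ξ
    rw [hZξ', map_zero, LinearMap.zero_apply] at this
    linarith
  refine ⟨?_, hv1, hv2⟩
  have hv : X (X (Z ξ)) + b ^ 2 • Z ξ = 0 := by
    have := LinearMap.congr_fun h ξ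
    simp only [LinearMap.add_apply, LinearMap.sub_apply, LinearMap.smul_apply,
      Module.End.mul_apply, hXξ, map_sub, LinearMap.zero_apply] at this
    rw [← this]
    module
  simp only [← Ring.lie_def] at h
  set N := wedge β (Z ξ) ξ' with hN
  have hlie : ∀ w, ⁅X, wedge β w ξ'⁆ = wedge β (X w) ξ' - wedge β w ξ' := by
    intro w
    rw [hX.lie_wedge, hXξ', map_neg, sub_eq_add_neg]
  have hNq : ⁅X, ⁅X, N⁆⁆ + (2 : ℝ) • ⁅X, N⁆ + (1 + b ^ 2) • N = 0 := by
    have h6 := congrArg (fun w => wedge β w ξ') hv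
    simp only [map_add, map_smul, LinearMap.add_apply, LinearMap.smul_apply, map_zero,
      LinearMap.zero_apply] at h6
    rw [hN, hlie, lie_sub, hlie, hlie, ← h6]
    module
  set G := Z - N with hG
  have hGs : IsSkew β G := fun x y => by
    have h7 := hZ x y
    have h8 := hβ.isSkew_wedge (Z ξ) ξ' x y
    simp only [hG, hN, LinearMap.sub_apply, map_sub, h7, h8]
    ring
  have hGξ : G ξ = 0 := by
    simp [hG, hN, wedge_apply, hp', hβ.symm (Z ξ) ξ, hv1]
  have hGξ' : G ξ' = 0 := by
    simp [hG, hN, wedge_apply, hξ', hβ.symm (Z ξ) ξ', hv2, hZξ']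
  have hGq : ⁅X, ⁅X, G⁆⁆ + (2 : ℝ) • ⁅X, G⁆ + (1 + b ^ 2) • G = 0 := by
    rw [← sub_eq_zero.mpr (h.trans hNq.symm), hG, lie_sub, lie_sub]
    module
  have htr : ∀ T : Module.End ℝ V, LinearMap.trace ℝ V (⁅X, T⁆ * T) = 0 := by
    intro T
    rw [Ring.lie_def, sub_mul, map_sub, LinearMap.trace_mul_comm ℝ (T * X) T, mul_assoc,
      LinearMap.trace_mul_comm ℝ X, sub_eq_zero, mul_assoc]
  have hF : ⁅X, G⁆ = 0 := by
    refine hβ.eq_zero_of_trace_sq_eq_zero (F := ⁅X, G⁆) (fun x y => ?_) hξ hp ?_ ?_ ?_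
    · simp only [Ring.lie_def, LinearMap.sub_apply, Module.End.mul_apply, map_sub, hX _ _, hGs _ _]
      ring
    · simp [Ring.lie_def, hXξ, hGξ]
    · simp [Ring.lie_def, hXξ', hGξ']
    · have h9 := congrArg (fun T => LinearMap.trace ℝ V (T * ⁅X, G⁆)) hGq
      simp only [add_mul, map_add, htr, smul_mul_assoc, map_smul, zero_mul, map_zero,
        LinearMap.trace_mul_comm ℝ G] at h9
      simpa using h9
  rw [hF, lie_zero, smul_zero, add_zero, zero_add] at hGq
  exact sub_eq_zero.mp ((smul_eq_zero.mp hGq).resolve_left (by positivity))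

theorem exists_wedge_mem_of_hyperbolic [FiniteDimensional ℝ V] (hβ : IsLorentzian β)
    {L : LieSubalgebra ℝ (Module.End ℝ V)} (hL : ∀ Y ∈ L, IsSkew β Y)
    (hirr : ∀ W : Submodule ℝ V, (∀ Y ∈ L, ∀ x ∈ W, Y x ∈ W) → W = ⊥ ∨ W = ⊤)
    {X : Module.End ℝ V} (hXL : X ∈ L) {ξ ξ' : V} (hξ : β ξ ξ = 0) (hξ' : β ξ' ξ' = 0)
    (hp : β ξ ξ' = 1) (hXξ : X ξ = ξ) (hXξ' : X ξ' = -ξ') :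
    ∃ v ≠ 0, β ξ v = 0 ∧ β ξ' v = 0 ∧ wedge β v ξ' ∈ L := by
  have h0 : ξ ≠ 0 := by rintro rfl; simp at hp
  have hp' : β ξ' ξ = 1 := by rw [hβ.symm, hp]
  have hX := hL X hXL
  obtain ⟨P, hP⟩ : ∃ P : Module.End ℝ V, ∀ x, P x = x - β ξ' x • ξ - β ξ x • ξ' :=
    ⟨1 - (β ξ').smulRight ξ - (β ξ).smulRight ξ', fun x => rfl⟩
  have hXP : ∀ x, X (P x) = P (X x) := by
    intro x
    have h1 := hX ξ x
    have h2 := hX ξ' x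
    simp only [hXξ, hXξ', map_neg, LinearMap.neg_apply, neg_inj] at h1 h2
    simp only [hP, map_sub, map_smul, hXξ, hXξ', ← h2, neg_eq_iff_eq_neg.mp h1.symm]
    module
  let U : Submodule ℝ V := L.toSubmodule.map (P ∘ₗ LinearMap.applyₗ ξ)
  have hU : ∀ Y ∈ L, P (Y ξ) ∈ U := fun Y hY => ⟨Y, hY, rfl⟩
  have hUX : ∀ u ∈ U, X u ∈ U := by
    rintro _ ⟨Y, hY, rfl⟩
    have h1 := hU _ (L.add_mem (L.lie_mem hXL hY) hY)
    rw [LinearMap.add_apply, Ring.lie_def, LinearMap.sub_apply, Module.End.mul_apply,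
      Module.End.mul_apply, hXξ, sub_add_cancel, ← hXP] at h1
    exact h1
  have hUne : U ≠ ⊥ := by
    intro hbot
    have hinv : ∀ Y ∈ L, ∀ x ∈ ℝ ∙ ξ, Y x ∈ ℝ ∙ ξ := by
      intro Y hY x hx
      obtain ⟨c, rfl⟩ := Submodule.mem_span_singleton.mp hx
      have h1 := hU Y hY
      rw [hbot, Submodule.mem_bot, hP, hβ.apply_self_eq_zero (hL Y hY), zero_smul, sub_zero,
        sub_eq_zero] at h1
      rw [map_smul, h1]
      exact Submodule.smul_mem _ _ (Submodule.smul_mem _ _ (Submodule.mem_span_singleton_self ξ))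
    rcases hirr (ℝ ∙ ξ) hinv with h | h
    · exact h0 (Submodule.span_singleton_eq_bot.mp h)
    · obtain ⟨c, rfl⟩ := Submodule.mem_span_singleton.mp (h ▸ Submodule.mem_top : ξ' ∈ ℝ ∙ ξ)
      simp [hξ] at hp
  have : Nontrivial U := Submodule.nontrivial_iff_ne_bot.mpr hUne
  obtain ⟨a, b, ⟨u, huU⟩, hu0, hu⟩ := exists_quadratic_root (X.restrict hUX)
  replace hu0 : u ≠ 0 := fun h => hu0 (Subtype.ext h)
  replace hu : X (X u) - (2 * a) • X u + (a ^ 2 + b ^ 2) • u = 0 := congrArg Subtype.val hu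
  obtain ⟨Y₀, hY₀, hYu⟩ := huU
  replace hYu : P (Y₀ ξ) = u := hYu
  have hu1 : β ξ u = 0 := by simp [← hYu, hP, hξ, hp]
  have hu2 : β ξ' u = 0 := by simp [← hYu, hP, hξ', hp']
  have hupos := hβ.pos_of_orthogonal_pair hξ hp hu1 hu2 hu0
  have ha : a = 0 := by
    by_contra ha
    obtain ⟨c, hc, hcu⟩ := hβ.exists_real_eigenvector hX hu0 ha hu
    have := hβ.apply_self_eq_zero hX u
    rw [hcu, map_smul, smul_eq_mul] at this
    exact (mul_ne_zero hc hupos.ne') this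
  have hXXu : X (X u) = -(b ^ 2 • u) := by
    rw [ha] at hu
    rw [eq_neg_iff_add_eq_zero, ← hu]
    module
  let D := LieAlgebra.ad ℝ L ⟨X, hXL⟩
  let T : Module.End ℝ L := D * D + (2 : ℝ) • D + (1 + b ^ 2) • 1
  have hT : ∀ Y : L, ((T Y : L) : Module.End ℝ V) =
      ⁅X, ⁅X, (Y : Module.End ℝ V)⁆⁆ + (2 : ℝ) • ⁅X, (Y : Module.End ℝ V)⁆ +
        (1 + b ^ 2) • (Y : Module.End ℝ V) := fun Y => rfl
  have hTs : ¬ Function.Surjective T := by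
    intro hs
    obtain ⟨Y, hY⟩ := hs ⟨Y₀, hY₀⟩
    have h1 : β (Y₀ ξ) u = β u u := by
      have := congrArg (fun w => β w u) hYu
      simpa [hP, hu1, hu2] using this
    have h2 : Y₀ = _ := (congrArg Subtype.val hY).symm.trans (hT Y)
    rw [h2] at h1
    have h3 := hX (X ((Y : Module.End ℝ V) ξ)) u
    have h4 := hX ((Y : Module.End ℝ V) ξ) u
    have h5 := hX ((Y : Module.End ℝ V) ξ) (X u)
    simp only [Ring.lie_def, LinearMap.add_apply, LinearMap.sub_apply, LinearMap.smul_apply,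
      Module.End.mul_apply, map_sub, map_add, map_smul, hXξ, hXXu, map_neg, smul_eq_mul]
      at h1 h3 h4 h5
    refine hupos.ne ?_
    rw [← h1, h3, h4, h5]
    ring
  rw [← LinearMap.injective_iff_surjective, ← LinearMap.ker_eq_bot] at hTs
  obtain ⟨Z, hZ, hZ0⟩ := Submodule.exists_mem_ne_zero_of_ne_bot hTs
  obtain ⟨h1, h2, h3⟩ := hβ.eq_wedge_of_lie_lie hX (hL Z Z.2) hξ hξ' hp hXξ hXξ' (b := b)
    (by rw [← hT, LinearMap.mem_ker.mp hZ]; rfl)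
  refine ⟨Z.1 ξ, fun h => hZ0 (Subtype.ext ?_), h2, h3, h1 ▸ Z.2⟩
  rw [h1, h]
  simp

theorem wedge_mem_of_eigenvector [FiniteDimensional ℝ V] (hβ : IsLorentzian β)
    {L : LieSubalgebra ℝ (Module.End ℝ V)} (hL : ∀ Y ∈ L, IsSkew β Y)
    (hirr : ∀ W : Submodule ℝ V, (∀ Y ∈ L, ∀ x ∈ W, Y x ∈ W) → W = ⊥ ∨ W = ⊤)
    {X : Module.End ℝ V} (hXL : X ∈ L) {c : ℝ} (hc : c ≠ 0) {ξ : V} (h0 : ξ ≠ 0)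
    (hXξ : X ξ = c • ξ) (x y : V) : wedge β x y ∈ L := by
  have hcXL := L.smul_mem c⁻¹ hXL
  have hcXξ : (c⁻¹ • X) ξ = ξ := by rw [LinearMap.smul_apply, hXξ, inv_smul_smul₀ hc]
  obtain ⟨hξ, ξ', hcXξ', hξ', hp⟩ := hβ.exists_opposite_eigenvector (hL _ hcXL) h0 hcXξ
  obtain ⟨v', hv0', hw, hw', hwL⟩ :=
    exists_wedge_mem_of_hyperbolic hβ hL hirr hcXL hξ hξ' hp hcXξ hcXξ'
  obtain ⟨v, hv0, hv', hv, hvL⟩ :=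
    exists_wedge_mem_of_hyperbolic hβ hL hirr (L.neg_mem hcXL) hξ' hξ (by rw [hβ.symm, hp])
      (by rw [LinearMap.neg_apply, hcXξ', neg_neg]) (by rw [LinearMap.neg_apply, hcXξ])
  exact wedge_mem_of_hyperbolic_pair hβ hL hirr hξ hξ' hp hv0 hv0' hv hv' hw hw' hvL hwL x y

/-- A self-adjoint endomorphism for a Lorentzian form that commutes with an irreducible set of
endomorphisms is a scalar. -/
theorem IsLorentzian.eq_smul_one_of_comm [FiniteDimensional ℝ V] (hβ : IsLorentzian β)
    (hdim : 3 ≤ Module.finrank ℝ V) {S : Set (Module.End ℝ V)}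
    (hirr : ∀ W : Submodule ℝ V, (∀ Y ∈ S, ∀ x ∈ W, Y x ∈ W) → W = ⊥ ∨ W = ⊤)
    {C : Module.End ℝ V} (hC : ∀ x y, β (C x) y = β x (C y)) (hcomm : ∀ Y ∈ S, Commute Y C) :
    ∃ a : ℝ, C = a • 1 := by
  have hker : ∀ Q : Module.End ℝ V, (∀ Y ∈ S, Commute Y Q) → ∀ v ≠ 0, Q v = 0 → Q = 0 := by
    intro Q hQ v hv hQv
    have hinv : ∀ Y ∈ S, ∀ x ∈ LinearMap.ker Q, Y x ∈ LinearMap.ker Q := by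
      intro Y hY x hx
      have h1 : Y (Q x) = Q (Y x) := LinearMap.congr_fun (hQ Y hY) x
      rw [LinearMap.mem_ker] at hx ⊢
      rw [← h1, hx, map_zero]
    rcases hirr _ hinv with h | h
    · exact absurd ((Submodule.eq_bot_iff _).mp h v hQv) hv
    · exact LinearMap.ker_eq_top.mp h
  have : Nontrivial V := Module.nontrivial_of_finrank_pos (R := ℝ) (by omega)
  obtain ⟨a, b, v, hv, hab⟩ := exists_quadratic_root C
  have hca : ∀ Y ∈ S, Commute Y (C - a • 1) := fun Y hY =>
    (hcomm Y hY).sub_right ((Commute.one_right Y).smul_right a)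
  have hJ : ∀ x, (C - a • 1) ((C - a • 1) x) = -(b ^ 2 • x) := by
    have h1 := hker ((C - a • 1) * (C - a • 1) + b ^ 2 • 1)
      (fun Y hY => ((hca Y hY).mul_right (hca Y hY)).add_right
        ((Commute.one_right Y).smul_right _)) v hv (by
          simp only [LinearMap.add_apply, Module.End.mul_apply, LinearMap.sub_apply,
            LinearMap.smul_apply, Module.End.one_apply, map_sub, map_smul]
          rw [← hab]
          module)
    intro x
    exact eq_neg_of_add_eq_zero_left (LinearMap.congr_fun h1 x)
  have hb : b = 0 := by
    by_contra hb
    obtain ⟨e, -, hpos⟩ := hβ.exists_timelike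
    set J := C - a • (1 : Module.End ℝ V) with hJdef
    have hJs : ∀ x y, β (J x) y = β x (J y) := by
      intro x y
      simp [hJdef, hC]
    have hne : LinearMap.ker ((β e).prod (β (J e))) ≠ ⊥ :=
      LinearMap.ker_ne_bot_of_finrank_lt (by simp; omega)
    obtain ⟨x, hx, hx0⟩ := Submodule.exists_mem_ne_zero_of_ne_bot hne
    obtain ⟨h1, h2⟩ : β e x = 0 ∧ β (J e) x = 0 := by simpa using hx
    have h3 := hpos x (by rw [hβ.symm, h1]) hx0
    have h4 : β (J x) (J x) = -(b ^ 2 * β x x) := by rw [hJs, hJ]; simp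
    have h5 : 0 ≤ β (J x) (J x) := by
      by_cases h0 : J x = 0
      · simp [h0]
      · exact (hpos _ (by rw [hβ.symm, ← hJs, h2]) h0).le
    have : 0 < b ^ 2 * β x x := by positivity
    linarith
  refine ⟨a, sub_eq_zero.mp ?_⟩
  by_cases h0 : (C - a • 1) v = 0
  · exact hker _ hca v hv h0
  · exact hker _ hca _ h0 (by rw [hJ, hb]; simp)

/-- A Lie algebra of skew endomorphisms on which the trace form is negative definite does not act
irreducibly: its Casimir element would be a scalar of impossible sign. -/
theorem IsLorentzian.not_trace_neg [FiniteDimensional ℝ V] (hβ : IsLorentzian β)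
    (hdim : 3 ≤ Module.finrank ℝ V) {L : LieSubalgebra ℝ (Module.End ℝ V)}
    (hL : ∀ Y ∈ L, IsSkew β Y)
    (hirr : ∀ W : Submodule ℝ V, (∀ Y ∈ L, ∀ x ∈ W, Y x ∈ W) → W = ⊥ ∨ W = ⊤)
    (hneg : ∀ Y ∈ L, Y ≠ 0 → LinearMap.trace ℝ V (Y * Y) < 0) : False := by
  let κ := LieModule.traceForm ℝ L V
  have hκ : ∀ Y Z : L, κ Y Z = LinearMap.trace ℝ V (Y.1 * Z.1) := fun Y Z => rfl
  have hκs : ∀ Y Z : L, κ Y Z = κ Z Y := fun Y Z => LieModule.traceForm_comm ℝ L V Y Z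
  obtain ⟨v, hv⟩ := LinearMap.BilinForm.exists_orthogonal_basis (B := κ) ⟨hκs⟩
  have hvneg : ∀ i, κ (v i) (v i) < 0 := fun i =>
    hneg _ (v i).2 fun h => v.ne_zero i (Subtype.ext h)
  let C : Module.End ℝ V := ∑ i, (-κ (v i) (v i))⁻¹ • ((v i).1 * (v i).1)
  have hCβ : ∀ x y, β (C x) y = -∑ i, (-κ (v i) (v i))⁻¹ * β ((v i).1 x) ((v i).1 y) := by
    intro x y
    simp only [C, LinearMap.sum_apply, map_sum, LinearMap.smul_apply, map_smul, smul_eq_mul,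
      Module.End.mul_apply, hL _ (v _).2 ((v _).1 x) y, mul_neg, Finset.sum_neg_distrib]
  have hCs : ∀ x y, β (C x) y = β x (C y) := by
    intro x y
    rw [hβ.symm x, hCβ, hCβ]
    simp only [hβ.symm ((v _).1 x)]
  have hcomm : ∀ Y ∈ L, Commute Y C := by
    intro Y hY
    let A : Fin _ → Fin _ → ℝ := fun i j => v.repr ⁅(⟨Y, hY⟩ : L), v i⁆ j
    have hA : ∀ i, ⁅Y, (v i).1⁆ = ∑ j, A i j • (v j).1 := by
      intro i
      have := congrArg L.subtype (v.sum_repr ⁅(⟨Y, hY⟩ : L), v i⁆)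
      rw [map_sum] at this
      exact this.symm
    have hAκ : ∀ i j, κ ⁅(⟨Y, hY⟩ : L), v i⁆ (v j) = A i j * κ (v j) (v j) := by
      intro i j
      conv_lhs => rw [← v.sum_repr ⁅(⟨Y, hY⟩ : L), v i⁆]
      rw [map_sum, LinearMap.sum_apply, Finset.sum_eq_single j]
      · simp [A]
      · intro k _ hk
        rw [map_smul, LinearMap.smul_apply, hv hk, smul_zero]
      · simp
    have hAs : ∀ i j, (-κ (v i) (v i))⁻¹ * A i j = -((-κ (v j) (v j))⁻¹ * A j i) := by
      intro i j
      have h1 : κ ⁅(⟨Y, hY⟩ : L), v i⁆ (v j) = -κ ⁅(⟨Y, hY⟩ : L), v j⁆ (v i) := by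
        rw [← lie_skew, map_neg, LinearMap.neg_apply, hκs _ (v i)]
        exact congrArg Neg.neg (LieModule.traceForm_apply_lie_apply ℝ L V _ _ _)
      rw [hAκ, hAκ] at h1
      have hi := (hvneg i).ne
      have hj := (hvneg j).ne
      field_simp
      linarith
    have h0 : Y * C - C * Y = ∑ i, ∑ j, ((-κ (v i) (v i))⁻¹ * A i j) •
        ((v j).1 * (v i).1 + (v i).1 * (v j).1) := by
      simp only [C, Finset.mul_sum, Finset.sum_mul, ← Finset.sum_sub_distrib]
      refine Finset.sum_congr rfl fun i _ => ?_
      have h2 : Y * (v i).1 = (v i).1 * Y + ∑ j, A i j • (v j).1 := by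
        rw [← hA, Ring.lie_def]; abel
      rw [mul_smul_comm, smul_mul_assoc, ← smul_sub, ← mul_assoc, h2, add_mul, mul_assoc, h2,
        mul_add, mul_assoc, add_assoc, add_sub_cancel_left, Finset.mul_sum, Finset.sum_mul,
        ← Finset.sum_add_distrib, Finset.smul_sum]
      refine Finset.sum_congr rfl fun j _ => ?_
      rw [smul_mul_assoc, mul_smul_comm]
      module
    have h3 : Y * C - C * Y = -(Y * C - C * Y) := by
      conv_lhs => rw [h0, Finset.sum_comm]
      rw [h0, ← Finset.sum_neg_distrib]
      refine Finset.sum_congr rfl fun i _ => ?_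
      rw [← Finset.sum_neg_distrib]
      refine Finset.sum_congr rfl fun j _ => ?_
      rw [hAs j i, neg_smul, add_comm]
    have h4 : (2 : ℝ) • (Y * C - C * Y) = 0 := by
      rw [two_smul]
      exact add_eq_zero_iff_eq_neg.mpr h3
    exact sub_eq_zero.mp ((smul_eq_zero.mp h4).resolve_left two_ne_zero)
  obtain ⟨a, ha⟩ := hβ.eq_smul_one_of_comm hdim (S := L) hirr hCs hcomm
  have htr : LinearMap.trace ℝ V C = -Module.finrank ℝ L := by
    have h1 : ∀ i, (-κ (v i) (v i))⁻¹ * LinearMap.trace ℝ V ((v i).1 * (v i).1) = -1 := by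
      intro i
      rw [← hκ]
      have := (hvneg i).ne
      field_simp
    simp only [C, map_sum, map_smul, smul_eq_mul, h1]
    simp
  obtain ⟨e, he, hpos⟩ := hβ.exists_timelike
  have hLpos : 0 < Module.finrank ℝ L := by
    by_contra h
    have hbot : ∀ Y ∈ L, Y = 0 := by
      intro Y hY
      have : Subsingleton L := (Module.finrank_zero_iff (R := ℝ) (M := L)).mp (by omega)
      exact congrArg Subtype.val (Subsingleton.elim (⟨Y, hY⟩ : L) 0)
    have he0 : e ≠ 0 := by rintro rfl; simp at he
    rcases hirr (ℝ ∙ e) (fun Y hY x _ => by simp [hbot Y hY]) with h1 | h1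
    · exact he0 (Submodule.span_singleton_eq_bot.mp h1)
    · have := finrank_span_singleton (K := ℝ) he0
      rw [h1, finrank_top] at this
      omega
  have ha0 : a < 0 := by
    rw [ha, map_smul, LinearMap.trace_one, smul_eq_mul] at htr
    have h1 : (0 : ℝ) < Module.finrank ℝ V := by exact_mod_cast (by omega)
    have h2 : (0 : ℝ) < Module.finrank ℝ L := by exact_mod_cast hLpos
    by_contra! h3
    nlinarith
  have h1 := hCβ e e
  have h2 : 0 ≤ ∑ i, (-κ (v i) (v i))⁻¹ * β ((v i).1 e) ((v i).1 e) := by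
    refine Finset.sum_nonneg fun i _ => mul_nonneg
      (inv_nonneg.mpr (neg_nonneg.mpr (hvneg i).le)) ?_
    by_cases h0 : (v i).1 e = 0
    · simp [h0]
    · refine (hpos _ ?_ h0).le
      rw [hβ.symm, hβ.apply_self_eq_zero (hL _ (v i).2)]
  rw [ha, LinearMap.smul_apply, Module.End.one_apply, map_smul, LinearMap.smul_apply,
    smul_eq_mul] at h1
  nlinarith

/-- A Lie algebra of skew endomorphisms for a Lorentzian form that acts irreducibly contains every
`wedge β x y`. -/
theorem IsLorentzian.wedge_mem [FiniteDimensional ℝ V] (hβ : IsLorentzian β)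
    (hdim : 3 ≤ Module.finrank ℝ V) {L : LieSubalgebra ℝ (Module.End ℝ V)}
    (hL : ∀ Y ∈ L, IsSkew β Y)
    (hirr : ∀ W : Submodule ℝ V, (∀ Y ∈ L, ∀ x ∈ W, Y x ∈ W) → W = ⊥ ∨ W = ⊤) (x y : V) :
    wedge β x y ∈ L := by
  by_cases hreal : ∀ X ∈ L, ∀ (c : ℝ) (v : V), v ≠ 0 → X v = c • v → c = 0
  swap
  · push Not at hreal
    obtain ⟨X, hX, c, v, hv, hXv, hc⟩ := hreal
    exact wedge_mem_of_eigenvector hβ hL hirr hX hc hv hXv x y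
  exfalso
  have htr : ∀ X ∈ L, LinearMap.trace ℝ V (X * X) ≤ 0 ∧
      (LinearMap.trace ℝ V (X * X) = 0 → IsNilpotent X) := fun X hX =>
    hβ.trace_sq_nonpos (hL X hX) (hreal X hX)
  obtain ⟨X, hX, hX0, htX⟩ : ∃ X ∈ L, X ≠ 0 ∧ LinearMap.trace ℝ V (X * X) = 0 := by
    by_contra! h
    exact hβ.not_trace_neg hdim hL hirr fun Y hY hY0 => lt_of_le_of_ne (htr Y hY).1 (h Y hY hY0)
  have hXY : ∀ Y ∈ L, LinearMap.trace ℝ V (X * Y) = 0 := by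
    intro Y hY
    by_contra hne
    have key : ∀ t : ℝ, LinearMap.trace ℝ V (Y * Y) + 2 * t * LinearMap.trace ℝ V (X * Y) ≤ 0 := by
      intro t
      have h1 := (htr (Y + t • X) (L.add_mem hY (L.smul_mem t hX))).1
      have h2 : (Y + t • X) * (Y + t • X) =
          Y * Y + t • (Y * X) + t • (X * Y) + (t * t) • (X * X) := by
        simp only [add_mul, mul_add, smul_mul_assoc, mul_smul_comm]
        module
      rw [h2] at h1
      simp only [map_add, map_smul, smul_eq_mul, htX, LinearMap.trace_mul_comm ℝ Y X] at h1
      linarith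
    have h1 := key ((1 - LinearMap.trace ℝ V (Y * Y)) / (2 * LinearMap.trace ℝ V (X * Y)))
    have h2 : 2 * ((1 - LinearMap.trace ℝ V (Y * Y)) / (2 * LinearMap.trace ℝ V (X * Y))) *
        LinearMap.trace ℝ V (X * Y) = 1 - LinearMap.trace ℝ V (Y * Y) := by
      field_simp
    linarith
  have trace_lie_mul : ∀ Y, ∀ Z ∈ L, (∀ T ∈ L, LinearMap.trace ℝ V (Y * T) = 0) →
      ∀ T ∈ L, LinearMap.trace ℝ V (⁅Y, Z⁆ * T) = 0 := by
    intro Y Z hZ h T hT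
    have h1 : LinearMap.trace ℝ V (⁅Y, Z⁆ * T) = LinearMap.trace ℝ V (Y * ⁅Z, T⁆) := by
      simp only [Ring.lie_def, sub_mul, mul_sub, map_sub, mul_assoc]
      rw [LinearMap.trace_mul_comm ℝ Z, mul_assoc]
    rw [h1, h _ (L.lie_mem hZ hT)]
  let r : LieSubalgebra ℝ (Module.End ℝ V) :=
    { carrier := {Y | Y ∈ L ∧ ∀ T ∈ L, LinearMap.trace ℝ V (Y * T) = 0}
      add_mem' := fun {a b} ha hb => ⟨L.add_mem ha.1 hb.1, fun T hT => by
        rw [add_mul, map_add, ha.2 T hT, hb.2 T hT, add_zero]⟩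
      zero_mem' := ⟨L.zero_mem, fun T _ => by simp⟩
      smul_mem' := fun c a ha => ⟨L.smul_mem c ha.1, fun T hT => by
        rw [smul_mul_assoc, map_smul, ha.2 T hT, smul_zero]⟩
      lie_mem' := fun {a b} ha hb => ⟨L.lie_mem ha.1 hb.1, trace_lie_mul a b hb.1 ha.2⟩ }
  have : Nontrivial V := Module.nontrivial_of_finrank_pos (R := ℝ) (by omega)
  have hnil : LieModule.IsNilpotent r V := (LieModule.isNilpotent_iff_forall (R := ℝ)).mpr
    fun Y => (htr _ Y.2.1).2 (Y.2.2 _ Y.2.1)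
  have := LieModule.nontrivial_max_triv_of_isNilpotent ℝ r V
  obtain ⟨w, hw⟩ := exists_ne (0 : LieModule.maxTrivSubmodule ℝ r V)
  let K : Submodule ℝ V := ⨅ Y : r, LinearMap.ker (Y.1 : Module.End ℝ V)
  have hK : ∀ v, v ∈ K ↔ ∀ Y ∈ r, Y v = 0 := fun v => by simp [K]
  have hinv : ∀ Y ∈ L, ∀ v ∈ K, Y v ∈ K := by
    intro Y hY v hv
    rw [hK] at hv ⊢
    intro Z hZ
    have h1 : ⁅Z, Y⁆ v = 0 := hv _ ⟨L.lie_mem hZ.1 hY, trace_lie_mul Z Y hY hZ.2⟩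
    rw [Ring.lie_def, LinearMap.sub_apply, Module.End.mul_apply, Module.End.mul_apply, hv Z hZ,
      map_zero, sub_zero] at h1
    exact h1
  rcases hirr K hinv with h | h
  · refine hw (Subtype.ext ((Submodule.eq_bot_iff K).mp h w.1 ((hK _).mpr fun Y hY => ?_)))
    exact (LieModule.mem_maxTrivSubmodule (R := ℝ) (L := r) (M := V) w.1).mp w.2 ⟨Y, hY⟩
  · refine hX0 (LinearMap.ext fun v => ?_)
    exact (hK v).mp (h ▸ Submodule.mem_top) X ⟨hX, hXY⟩

end Lorentz

section Matrix

variable {n : ℕ}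

theorem isLorentzian_toBilin'_diagonal :
    IsLorentzian (Matrix.toBilin' (Matrix.diagonal fun i : Fin (n + 1) =>
      if i = 0 then (-1 : ℝ) else 1)) where
  symm x y := by
    simp only [Matrix.toBilin'_apply', Matrix.mulVec_diagonal, dotProduct]
    exact Finset.sum_congr rfl fun i _ => by ring
  exists_timelike := by
    refine ⟨Pi.single 0 1, by simp [Matrix.toBilin'_apply'], fun x hx hx0 => ?_⟩
    have h0 : x 0 = 0 := by simpa [Matrix.toBilin'_apply', Matrix.mulVec_diagonal] using hx
    have h1 : Matrix.toBilin' (Matrix.diagonal fun i : Fin (n + 1) =>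
        if i = 0 then (-1 : ℝ) else 1) x x = ∑ i, x i ^ 2 := by
      simp only [Matrix.toBilin'_apply', Matrix.mulVec_diagonal, dotProduct]
      refine Finset.sum_congr rfl fun i _ => ?_
      split_ifs with hi
      · simp [hi, h0]
      · ring
    obtain ⟨i, hi⟩ := Function.ne_iff.mp hx0
    rw [h1]
    exact Finset.sum_pos' (fun j _ => sq_nonneg _) ⟨i, Finset.mem_univ i, sq_pos_of_ne_zero hi⟩

theorem isSkew_toLin'_iff {η M : Matrix (Fin n) (Fin n) ℝ} :
    IsSkew (Matrix.toBilin' η) (Matrix.toLin' M) ↔ Mᵀ * η + η * M = 0 := by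
  have key : ∀ x y, Matrix.toBilin' η (Matrix.toLin' M x) y +
      Matrix.toBilin' η x (Matrix.toLin' M y) = Matrix.toBilin' (Mᵀ * η + η * M) x y := by
    intro x y
    simp only [Matrix.toBilin'_apply', Matrix.toLin'_apply, Matrix.add_mulVec, dotProduct_add,
      ← Matrix.mulVec_mulVec, Matrix.dotProduct_mulVec x Mᵀ, Matrix.vecMul_transpose]
  constructor
  · intro h
    refine Matrix.toBilin'.map_eq_zero_iff.mp (LinearMap.ext₂ fun x y => ?_)
    rw [← key, h, neg_add_cancel, LinearMap.zero_apply, LinearMap.zero_apply]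
  · intro h x y
    rw [eq_neg_iff_add_eq_zero, key, h, map_zero, LinearMap.zero_apply, LinearMap.zero_apply]

/-- Twice a skew endomorphism is a sum of wedges of the vectors of an orthonormal basis with their
images. -/
theorem IsSkew.two_smul_eq_sum_wedge {d : Fin n → ℝ} (hd : ∀ i, d i * d i = 1)
    {X : Module.End ℝ (Fin n → ℝ)} (hX : IsSkew (Matrix.toBilin' (Matrix.diagonal d)) X) :
    (2 : ℝ) • X = ∑ i, d i • wedge (Matrix.toBilin' (Matrix.diagonal d))
      (X (Pi.single i 1)) (Pi.single i 1) := by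
  have hsum : ∀ x : Fin n → ℝ, ∑ i, (d i * (Matrix.toBilin' (Matrix.diagonal d)
      (Pi.single i 1) x)) • (Pi.single i (1 : ℝ) : Fin n → ℝ) = x := by
    intro x
    ext j
    simp [Matrix.toBilin'_apply', Matrix.mulVec_diagonal, Finset.sum_apply, Pi.single_apply,
      ← mul_assoc, hd]
  refine LinearMap.ext fun x => ?_
  have h1 := hsum (X x)
  have h2 := congrArg X (hsum x)
  simp only [map_sum, map_smul] at h2
  rw [LinearMap.smul_apply, two_smul, LinearMap.sum_apply]
  refine (congrArg₂ (· + ·) h1 h2).symm.trans ?_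
  rw [← Finset.sum_add_distrib]
  refine Finset.sum_congr rfl fun i _ => ?_
  rw [LinearMap.smul_apply, wedge_apply, hX]
  module

end Matrix

theorem irreducible_subalgebra_of_lorentz_is_full
    {n : ℕ} (hn : 2 ≤ n)
    (η : Matrix (Fin (n + 1)) (Fin (n + 1)) ℝ)
    (hη : η = Matrix.diagonal (fun i => if i = 0 then (-1 : ℝ) else 1))
    (h : Submodule ℝ (Matrix (Fin (n + 1)) (Fin (n + 1)) ℝ))
    (hso : ∀ M ∈ h, Mᵀ * η + η * M = 0)
    (hlie : ∀ M ∈ h, ∀ P ∈ h, M * P - P * M ∈ h)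
    (hirr : ∀ W : Submodule ℝ (Fin (n + 1) → ℝ),
      (∀ M ∈ h, ∀ x ∈ W, M.mulVec x ∈ W) → W = ⊥ ∨ W = ⊤) :
    ∀ M : Matrix (Fin (n + 1)) (Fin (n + 1)) ℝ, M ∈ h ↔ Mᵀ * η + η * M = 0 := by
  refine fun M => ⟨hso M, fun hM => ?_⟩
  subst hη
  let : LieRing (Module.End ℝ (Fin (n + 1) → ℝ)) := LieRing.ofAssociativeRing
  let L : LieSubalgebra ℝ (Module.End ℝ (Fin (n + 1) → ℝ)) :=
    { h.comap (LinearMap.toMatrix' : _ ≃ₗ[ℝ] Matrix (Fin (n + 1)) (Fin (n + 1)) ℝ).toLinearMap with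
      lie_mem' := fun {X Y} hX hY => by
        have h1 := hlie _ hX _ hY
        rwa [LinearEquiv.coe_coe, ← LinearMap.toMatrix'_mul, ← LinearMap.toMatrix'_mul,
          ← map_sub] at h1 }
  have hmem : ∀ X, X ∈ L ↔ LinearMap.toMatrix' X ∈ h := fun X => Iff.rfl
  have hskew : ∀ X ∈ L, IsSkew (Matrix.toBilin' (Matrix.diagonal fun i : Fin (n + 1) =>
      if i = 0 then (-1 : ℝ) else 1)) X := fun X hX => by
    rw [← Matrix.toLin'_toMatrix' X]
    exact isSkew_toLin'_iff.mpr (hso _ hX)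
  have hX := (isSkew_toLin'_iff.mpr hM).two_smul_eq_sum_wedge (fun i => by split_ifs <;> norm_num)
  have hmul : (2 : ℝ) • Matrix.toLin' M ∈ L := by
    rw [hX]
    refine L.toSubmodule.sum_mem fun i _ => L.smul_mem _
      (isLorentzian_toBilin'_diagonal.wedge_mem (by simp; omega) hskew (fun W hW => ?_) _ _)
    refine hirr W fun P hP x hx => hW (Matrix.toLin' P) ?_ x hx
    rwa [hmem, LinearMap.toMatrix'_toLin']
  have h2 := L.smul_mem (2⁻¹ : ℝ) hmul
  rwa [smul_smul, inv_mul_cancel₀ two_ne_zero, one_smul, hmem, LinearMap.toMatrix'_toLin'] at h2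
end

section
/- Let m ≥ 1 and equip ℝ^{m+2} with the Lorentzian form of signature (1,m+1). Let 𝔥 ⊆ 𝔰𝔬(1,m+1) be a Lie subalgebra acting weakly irreducibly but non-irreducibly on ℝ^{m+2}, i.e. some proper nonzero 𝔥-invariant subspace exists, and every proper nonzero 𝔥-invariant subspace is degenerate. Then, in a suitable basis (v, e_1, …, e_m, w) with ⟨v,v⟩ = ⟨w,w⟩ = ⟨v,e_i⟩ = ⟨w,e_i⟩ = 0, ⟨e_i,e_j⟩ = δ_ij, ⟨v,w⟩ = 1 (equivalently, up to conjugation by an element of the orthogonal group of the form), 𝔥 is contained in (ℝ ⊕ 𝔰𝔬(m)) ⋉ ℝ^m = { [[a, wᵀ, 0],[0, A, w],[0, 0, -a]] : a ∈ ℝ, A ∈ 𝔰𝔬(m), w ∈ ℝ^m }, and, setting 𝔤 := pr_{𝔰𝔬(m)}(𝔥), the algebra 𝔥 is of one of the following four types: Type 1: 𝔥 = { [[a, wᵀ, 0],[0, A, w],[0, 0, -a]] : a ∈ ℝ, A ∈ 𝔤, w ∈ ℝ^m }; Type 2: 𝔥 = { [[0, wᵀ, 0],[0, A, w],[0, 0,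 0]] : A ∈ 𝔤, w ∈ ℝ^m }; Type 3: there exists a surjective Lie algebra homomorphism φ : 𝔤 → ℝ with φ|_{[𝔤,𝔤]} = 0 such that 𝔥 = { [[φ(A), wᵀ, 0],[0, A, w],[0, 0, -φ(A)]] : A ∈ 𝔤, w ∈ ℝ^m }; Type 4: there exists 0 < ℓ < m with ℝ^m = ℝ^ℓ ⊕ ℝ^{m-ℓ}, 𝔤 ⊆ 𝔰𝔬(ℓ), and a surjective linear map ψ : 𝔤 → ℝ^{m-ℓ} with ψ|_{[𝔤,𝔤]} = 0 such that 𝔥 = { [[0, ψ(A)ᵀ, wᵀ, 0],[0, 0, 0, -ψ(A)],[0, 0, A, -w],[0, 0, 0, 0]] : A ∈ 𝔤, w ∈ ℝ^ℓ }, where the blocks refer to the decomposition spanned by v, the ℝ^{m-ℓ} part, the ℝ^ℓ part, and w. -/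
open Matrix

/-- The model of Lorentzian `ℝ^{m+2}` in the null basis `(v, e₁, …, e_m, w)`:
coordinates `(α, x, β)` correspond to `α·v + Σ xᵢ·eᵢ + β·w`. -/
abbrev LSp (m : ℕ) := ℝ × (Fin m → ℝ) × ℝ

/-- The Lorentzian form of signature `(1, m+1)` with `⟨v,v⟩ = ⟨w,w⟩ = ⟨v,eᵢ⟩ = ⟨w,eᵢ⟩ = 0`,
`⟨eᵢ,eⱼ⟩ = δᵢⱼ` and `⟨v,w⟩ = 1`. -/
noncomputable def LForm {m : ℕ} (x y : LSp m) : ℝ :=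
  x.1 * y.2.2 + x.2.2 * y.1 + ∑ i, x.2.1 i * y.2.1 i

/-- The element of `(ℝ ⊕ 𝔰𝔬(m)) ⋉ ℝ^m ⊆ 𝔰𝔬(1,m+1)` determined by
`a ∈ ℝ`, `A ∈ gl(m)` and `u ∈ ℝ^m`: in the basis `(v, e, w)` it is the matrix
`[[a, uᵀ, 0], [0, A, -u], [0, 0, -a]]` (for `A` skew this is skew w.r.t. `LForm`). -/
noncomputable def stdFun (m : ℕ) (a : ℝ) (A : Matrix (Fin m) (Fin m) ℝ)
    (u : Fin m → ℝ) (x : LSp m) : LSp m :=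
  (a * x.1 + ∑ i, u i * x.2.1 i, A.mulVec x.2.1 - x.2.2 • u, -(a * x.2.2))

/-- The conjugate `φ⁻¹ ∘ 𝔥 ∘ φ` of a family of endomorphisms. -/
noncomputable def conjSet (m : ℕ) (φ : LSp m ≃ₗ[ℝ] LSp m)
    (hsub : Submodule ℝ (LSp m →ₗ[ℝ] LSp m)) : Set (LSp m →ₗ[ℝ] LSp m) :=
  (fun H => φ.symm.toLinearMap ∘ₗ H ∘ₗ φ.toLinearMap) '' (hsub : Set (LSp m →ₗ[ℝ] LSp m))

/-- The projection `𝔤 = pr_{𝔰𝔬(m)}(𝔥)` of a family contained in `(ℝ ⊕ 𝔰𝔬(m)) ⋉ ℝ^m`. -/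
noncomputable def gProj (m : ℕ) (S : Set (LSp m →ₗ[ℝ] LSp m)) :
    Set (Matrix (Fin m) (Fin m) ℝ) :=
  {A | ∃ H ∈ S, ∃ (a : ℝ) (u : Fin m → ℝ), ⇑H = stdFun m a A u}


section LinearAlgebra

/-- A subspace of a product which meets the second factor trivially lies in the graph of a
linear map. -/
theorem exists_linearMap_of_graph {V W : Type*} [AddCommGroup V] [Module ℝ V] [AddCommGroup W]
    [Module ℝ W] (S : Submodule ℝ (V × W)) (hS : ∀ w, ((0 : V), w) ∈ S → w = 0) :
    ∃ f : V →ₗ[ℝ] W, ∀ v w, (v, w) ∈ S → f v = w := by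
  obtain ⟨g, hg⟩ := LinearMap.exists_leftInverse_of_injective
    ((LinearMap.fst ℝ V W) ∘ₗ S.subtype) (by
      rw [LinearMap.ker_eq_bot']
      rintro ⟨⟨v, w⟩, h⟩ h0
      obtain rfl : v = 0 := h0
      have := hS w h
      subst this
      rfl)
  refine ⟨LinearMap.snd ℝ V W ∘ₗ S.subtype ∘ₗ g, fun v w h => ?_⟩
  have := LinearMap.congr_fun hg ⟨(v, w), h⟩
  simp only [LinearMap.comp_apply, Submodule.subtype_apply, LinearMap.fst_apply,
    LinearMap.id_apply] at this
  simp [this]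

/-- The orthogonal complement with respect to the dot product. -/
def dotPerp {m : ℕ} (Q : Submodule ℝ (Fin m → ℝ)) : Submodule ℝ (Fin m → ℝ) where
  carrier := {x | ∀ q ∈ Q, q ⬝ᵥ x = 0}
  add_mem' hx hy q hq := by rw [dotProduct_add, hx q hq, hy q hq, add_zero]
  zero_mem' q _ := dotProduct_zero q
  smul_mem' c x hx q hq := by rw [dotProduct_smul, hx q hq, smul_zero]

theorem eq_top_of_dotPerp_eq_bot {m : ℕ} {Q : Submodule ℝ (Fin m → ℝ)} (h : dotPerp Q = ⊥) :
    Q = ⊤ := by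
  by_contra hQ
  obtain ⟨f, hf, hle⟩ := Submodule.exists_le_ker_of_lt_top Q (lt_top_iff_ne_top.2 hQ)
  have hdot : ∀ q, f q = q ⬝ᵥ fun i => f (Pi.single i 1) := by
    intro q
    conv_lhs => rw [pi_eq_sum_univ' q]
    simp [dotProduct]
  have hmem : (fun i => f (Pi.single i 1)) ∈ dotPerp Q := fun q hq => by
    rw [← hdot]
    exact hle hq
  rw [h, Submodule.mem_bot] at hmem
  apply hf
  ext q
  simp [congrFun hmem]

/-- Least squares problems are solvable via the normal equations. -/
theorem exists_normal_equation {n m : Type*} [Fintype n] [Fintype m]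
    (M : Matrix n m ℝ) (y : n → ℝ) : ∃ p, Mᵀ *ᵥ (M *ᵥ p) = Mᵀ *ᵥ y := by
  classical
  have hle : LinearMap.range (Mᵀ * M).mulVecLin ≤ LinearMap.range Mᵀ.mulVecLin := by
    rw [Matrix.mulVecLin_mul]
    exact LinearMap.range_comp_le_range _ _
  have heq := Submodule.eq_of_le_of_finrank_eq hle (by
    change (Mᵀ * M).rank = Mᵀ.rank
    rw [Matrix.rank_transpose_mul_self, Matrix.rank_transpose])
  have : Mᵀ *ᵥ y ∈ LinearMap.range (Mᵀ * M).mulVecLin := heq ▸ ⟨y, rfl⟩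
  obtain ⟨p, hp⟩ := this
  exact ⟨p, by rw [mulVec_mulVec]; exact hp⟩

theorem exists_orthonormal_basis_of_posDef {V : Type*} [AddCommGroup V] [Module ℝ V]
    [FiniteDimensional ℝ V] (B : V →ₗ[ℝ] V →ₗ[ℝ] ℝ) (hsymm : ∀ x y, B x y = B y x)
    (hpos : ∀ x, x ≠ 0 → 0 < B x x) :
    ∃ (n : ℕ) (b : Module.Basis (Fin n) ℝ V), ∀ i j, B (b i) (b j) = if i = j then 1 else 0 := by
  have hnonneg : ∀ x, 0 ≤ B x x := fun x => by
    rcases eq_or_ne x 0 with rfl | h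
    · simp
    · exact (hpos x h).le
  let core : InnerProductSpace.Core ℝ V :=
    { inner := fun x y => B x y
      conj_inner_symm := fun x y => by simp [hsymm x y]
      re_inner_nonneg := fun x => by simpa using hnonneg x
      add_left := fun x y z => by simp
      smul_left := fun x y r => by simp
      definite := fun x hx => by
        by_contra h
        exact (hpos x h).ne' hx }
  let _ : NormedAddCommGroup V := core.toNormedAddCommGroup
  let _ : InnerProductSpace ℝ V := InnerProductSpace.ofCore core.toCore
  let b := stdOrthonormalBasis ℝ V
  refine ⟨_, b.toBasis, fun i j => ?_⟩
  rw [b.coe_toBasis]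
  exact orthonormal_iff_ite.1 b.orthonormal i j

/-- A cocycle on a Lie algebra with an invariant inner product differs from a coboundary
by a cocycle with invariant values. -/
theorem exists_sub_coboundary_invariant {m : ℕ} {V : Type*} [AddCommGroup V] [Module ℝ V]
    [FiniteDimensional ℝ V] (B : V →ₗ[ℝ] V →ₗ[ℝ] ℝ) (hsymm : ∀ x y, B x y = B y x)
    (hpos : ∀ x, x ≠ 0 → 0 < B x x) (br : V → V → V)
    (hinv : ∀ x y z, B (br y x) z = - B x (br y z))
    (ρ : V →ₗ[ℝ] Matrix (Fin m) (Fin m) ℝ)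
    (hρ : ∀ x y, ρ (br y x) = ρ y * ρ x - ρ x * ρ y)
    (hρt : ∀ x y, ρ y * (ρ x)ᵀ = (ρ (br y x))ᵀ + (ρ x)ᵀ * ρ y)
    (U : V →ₗ[ℝ] (Fin m → ℝ))
    (hU : ∀ x y, U (br y x) = ρ y *ᵥ U x - ρ x *ᵥ U y) :
    ∃ p : Fin m → ℝ, ∀ x y, ρ x *ᵥ (U y - ρ y *ᵥ p) = 0 := by
  obtain ⟨n, b, hb⟩ := exists_orthonormal_basis_of_posDef B hsymm hpos
  obtain ⟨p, hp⟩ := exists_normal_equation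
    (Matrix.of fun (q : Fin n × Fin m) (j : Fin m) => ρ (b q.1) q.2 j)
    (fun q => U (b q.1) q.2)
  refine ⟨p, ?_⟩
  let G : V →ₗ[ℝ] (Fin m → ℝ) := U - (Matrix.mulVecBilin ℝ ℝ).flip p ∘ₗ ρ
  have hG : ∀ y, G y = U y - ρ y *ᵥ p := fun y => rfl
  have hGbr : ∀ x y, G (br y x) = ρ y *ᵥ G x - ρ x *ᵥ G y := by
    intro x y
    simp only [hG, hU, hρ, mulVec_sub, sub_mulVec, mulVec_mulVec]
    abel
  have hsum : ∑ i, (ρ (b i))ᵀ *ᵥ G (b i) = 0 := by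
    ext j
    have := congrFun hp j
    simp only [mulVec, dotProduct, transpose_apply, of_apply, Fintype.sum_prod_type] at this
    simp only [Finset.sum_apply, hG, mulVec_sub, Pi.sub_apply, Finset.sum_sub_distrib,
      Pi.zero_apply]
    simp only [mulVec, dotProduct, transpose_apply]
    rw [this, sub_self]
  have hexp : ∀ z, z = ∑ j, B z (b j) • b j := by
    intro z
    conv_lhs => rw [← b.sum_repr z]
    refine Finset.sum_congr rfl fun j _ => ?_
    congr 1
    have := congrArg (fun x => B x (b j)) (b.sum_repr z)
    simp only [map_sum, map_smul, LinearMap.sum_apply, LinearMap.smul_apply, hb, smul_eq_mul,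
      mul_ite, mul_one, mul_zero, Finset.sum_ite_eq', Finset.mem_univ, if_true] at this
    exact this
  have key : ∀ y, ∑ i, (ρ (b i))ᵀ *ᵥ (ρ (b i) *ᵥ G y) = 0 := by
    intro y
    have h1 : ∑ i, ((ρ (br y (b i)))ᵀ *ᵥ G (b i) + (ρ (b i))ᵀ *ᵥ G (br y (b i))) = 0 := by
      have e1 : ∀ i, (ρ (br y (b i)))ᵀ *ᵥ G (b i)
          = ∑ j, B (br y (b i)) (b j) • ((ρ (b j))ᵀ *ᵥ G (b i)) := by
        intro i
        conv_lhs => rw [hexp (br y (b i))]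
        simp [transpose_sum, sum_mulVec, smul_mulVec]
      have e2 : ∀ i, (ρ (b i))ᵀ *ᵥ G (br y (b i))
          = ∑ j, B (br y (b i)) (b j) • ((ρ (b i))ᵀ *ᵥ G (b j)) := by
        intro i
        conv_lhs => rw [hexp (br y (b i))]
        simp [mulVec_sum, mulVec_smul]
      rw [Finset.sum_add_distrib]
      simp only [e1, e2]
      conv_lhs => enter [2]; rw [Finset.sum_comm]
      rw [← Finset.sum_add_distrib]
      refine Finset.sum_eq_zero fun i _ => ?_
      rw [← Finset.sum_add_distrib]
      refine Finset.sum_eq_zero fun j _ => ?_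
      rw [hinv (b j) y (b i), hsymm (b j), neg_smul, add_neg_cancel]
    have h2 := congrArg (ρ y *ᵥ ·) hsum
    simp only [mulVec_sum, mulVec_zero, mulVec_mulVec, hρt] at h2
    rw [← h2, eq_comm, ← sub_eq_zero, ← h1, ← Finset.sum_sub_distrib]
    refine Finset.sum_congr rfl fun i _ => ?_
    rw [hGbr, add_mulVec, mulVec_sub, mulVec_mulVec, mulVec_mulVec]
    abel
  intro x y
  have hz : ∀ i, ρ (b i) *ᵥ G y = 0 := by
    have h := congrArg (G y ⬝ᵥ ·) (key y)
    simp only [dotProduct_sum, dotProduct_zero, dotProduct_mulVec, vecMul_transpose] at h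
    rw [Finset.sum_eq_zero_iff_of_nonneg] at h
    · intro i
      have := h i (Finset.mem_univ _)
      simpa [← dotProduct_mulVec] using this
    · intro i _
      rw [← dotProduct_mulVec]
      exact Finset.sum_nonneg fun j _ => mul_self_nonneg _
  rw [← hG, hexp x]
  simp [sum_mulVec, smul_mulVec, hz]

end LinearAlgebra

section Lorentz

variable {m : ℕ}

/-- `stdFun` as an endomorphism depending linearly on the parameters `(a, A, u)`. -/
noncomputable def stdLin (m : ℕ) :
    (ℝ × Matrix (Fin m) (Fin m) ℝ × (Fin m → ℝ)) →ₗ[ℝ] (LSp m →ₗ[ℝ] LSp m) :=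
  LinearMap.mk₂ ℝ (fun X => stdFun m X.1 X.2.1 X.2.2)
    (fun X Y x => by
      refine Prod.ext ?_ (Prod.ext ?_ ?_)
      · simp [stdFun, add_mul, Finset.sum_add_distrib]; ring
      · simp [stdFun, add_mulVec, smul_add]; abel
      · simp [stdFun]; ring)
    (fun c X x => by
      refine Prod.ext ?_ (Prod.ext ?_ ?_)
      · simp [stdFun, Finset.mul_sum, mul_add, mul_assoc]
      · simp [stdFun, smul_mulVec, smul_sub, smul_comm c]
      · simp [stdFun, mul_assoc])
    (fun X x y => by
      refine Prod.ext ?_ (Prod.ext ?_ ?_)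
      · simp [stdFun, mul_add, Finset.sum_add_distrib]; ring
      · simp [stdFun, mulVec_add, add_smul]; abel
      · simp [stdFun]; ring)
    (fun c X x => by
      refine Prod.ext ?_ (Prod.ext ?_ ?_)
      · simp [stdFun, Finset.mul_sum, mul_add, mul_left_comm]
      · simp [stdFun, mulVec_smul, smul_sub, smul_smul]
      · simp [stdFun, mul_left_comm])

theorem coe_stdLin (a : ℝ) (A : Matrix (Fin m) (Fin m) ℝ) (u : Fin m → ℝ) :
    ⇑(stdLin m (a, A, u)) = stdFun m a A u := rfl

theorem stdLin_apply (a : ℝ) (A : Matrix (Fin m) (Fin m) ℝ) (u : Fin m → ℝ) (x : LSp m) :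
    stdLin m (a, A, u) x = (a * x.1 + u ⬝ᵥ x.2.1, A *ᵥ x.2.1 - x.2.2 • u, -(a * x.2.2)) := rfl

theorem coe_eq_stdFun_iff {H : LSp m →ₗ[ℝ] LSp m} {a : ℝ} {A : Matrix (Fin m) (Fin m) ℝ}
    {u : Fin m → ℝ} : ⇑H = stdFun m a A u ↔ H = stdLin m (a, A, u) := by
  rw [← coe_stdLin, DFunLike.coe_fn_eq]

theorem stdLin_injective : Function.Injective (stdLin m) := by
  refine (injective_iff_map_eq_zero _).2 ?_
  rintro ⟨a, A, u⟩ h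
  have hx := fun x => LinearMap.congr_fun h x
  simp only [stdLin_apply, LinearMap.zero_apply] at hx
  have ha : a = 0 := by simpa using congrArg Prod.fst (hx (1, 0, 0))
  have hu : u = 0 := by simpa using congrArg (fun z => z.2.1) (hx (0, 0, 1))
  have hA : A = 0 := by
    ext i j
    have := congrFun (congrArg (fun z => z.2.1) (hx (0, Pi.single j 1, 0))) i
    simpa using this
  rw [ha, hu, hA]
  rfl

theorem LForm_eq (x y : LSp m) :
    LForm x y = x.1 * y.2.2 + x.2.2 * y.1 + x.2.1 ⬝ᵥ y.2.1 := rfl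

theorem LForm_smul_smul (c d : ℝ) (x y : LSp m) :
    LForm (c • x) (d • y) = c * d * LForm x y := by
  simp only [LForm_eq, Prod.smul_fst, Prod.smul_snd, smul_dotProduct, dotProduct_smul, smul_eq_mul]
  ring

theorem stdLin_commutator {a b : ℝ} {A B : Matrix (Fin m) (Fin m) ℝ} {u v : Fin m → ℝ}
    (hA : Aᵀ = -A) (hB : Bᵀ = -B) :
    stdLin m (a, A, u) * stdLin m (b, B, v) - stdLin m (b, B, v) * stdLin m (a, A, u)
      = stdLin m (0, A * B - B * A, (A *ᵥ v + a • v) - (B *ᵥ u + b • u)) := by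
  have h1 : ∀ x, (A *ᵥ v) ⬝ᵥ x = - (v ⬝ᵥ (A *ᵥ x)) := fun x => by
    rw [dotProduct_mulVec, ← mulVec_transpose, hA, neg_mulVec, neg_dotProduct, neg_neg]
  have h2 : ∀ x, (B *ᵥ u) ⬝ᵥ x = - (u ⬝ᵥ (B *ᵥ x)) := fun x => by
    rw [dotProduct_mulVec, ← mulVec_transpose, hB, neg_mulVec, neg_dotProduct, neg_neg]
  refine LinearMap.ext fun x => ?_
  simp only [LinearMap.sub_apply, Module.End.mul_apply, stdLin_apply]
  refine Prod.ext ?_ (Prod.ext ?_ ?_)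
  · simp only [Prod.fst_sub, sub_dotProduct, add_dotProduct, smul_dotProduct, h1, h2,
      dotProduct_sub, dotProduct_smul, smul_eq_mul]
    rw [dotProduct_comm v u]
    ring
  · simp only [Prod.snd_sub, Prod.fst_sub, mulVec_sub, mulVec_smul, sub_mulVec, mulVec_mulVec,
      smul_sub, smul_add, neg_smul, smul_smul]
    rw [mul_comm a, mul_comm b]
    abel
  · simp only [Prod.snd_sub]
    ring

/-- The linear isometries of the Lorentzian form. -/
def IsLIsometry (ψ : LSp m ≃ₗ[ℝ] LSp m) : Prop :=
  ∀ x y, LForm (ψ x) (ψ y) = LForm x y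

/-- The null translation fixing `v` and taking `w` to `-|p|²/2 v + p + w`. -/
noncomputable def nullTranslation (p : Fin m → ℝ) : LSp m ≃ₗ[ℝ] LSp m where
  toFun x := (x.1 - p ⬝ᵥ x.2.1 - (p ⬝ᵥ p) / 2 * x.2.2, x.2.1 + x.2.2 • p, x.2.2)
  map_add' x y := by
    refine Prod.ext ?_ (Prod.ext ?_ ?_)
    · simp [dotProduct_add]; ring
    · simp [add_smul]; abel
    · simp
  map_smul' c x := by
    refine Prod.ext ?_ (Prod.ext ?_ ?_)
    · simp; ring
    · simp [smul_smul]
    · simp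
  invFun x := (x.1 + p ⬝ᵥ x.2.1 - (p ⬝ᵥ p) / 2 * x.2.2, x.2.1 - x.2.2 • p, x.2.2)
  left_inv x := by
    refine Prod.ext ?_ (Prod.ext ?_ ?_)
    · simp [dotProduct_add]; ring
    · simp
    · simp
  right_inv x := by
    refine Prod.ext ?_ (Prod.ext ?_ ?_)
    · simp [dotProduct_sub]; ring
    · simp
    · simp

theorem nullTranslation_apply (p : Fin m → ℝ) (x : LSp m) : nullTranslation p x =
    (x.1 - p ⬝ᵥ x.2.1 - (p ⬝ᵥ p) / 2 * x.2.2, x.2.1 + x.2.2 • p, x.2.2) := rfl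

theorem nullTranslation_isLIsometry (p : Fin m → ℝ) : IsLIsometry (nullTranslation p) := by
  intro x y
  simp only [nullTranslation_apply, LForm_eq, add_dotProduct, dotProduct_add, smul_dotProduct,
    dotProduct_smul, smul_eq_mul]
  rw [dotProduct_comm x.2.1 p]
  ring

/-- The isometry exchanging the two null basis vectors. -/
def nullSwap (m : ℕ) : LSp m ≃ₗ[ℝ] LSp m where
  toFun x := (x.2.2, x.2.1, x.1)
  map_add' _ _ := rfl
  map_smul' _ _ := rfl
  invFun x := (x.2.2, x.2.1, x.1)
  left_inv _ := rfl
  right_inv _ := rfl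

theorem nullSwap_isLIsometry : IsLIsometry (nullSwap m) := by
  intro x y
  simp only [nullSwap, LinearEquiv.coe_mk, LinearMap.coe_mk, AddHom.coe_mk, LForm_eq]
  ring

/-- The isometry given by an orthogonal transformation of the span of the `eᵢ`. -/
def nullRotation (R : Matrix (Fin m) (Fin m) ℝ) (h : Rᵀ * R = 1) : LSp m ≃ₗ[ℝ] LSp m where
  toFun x := (x.1, R *ᵥ x.2.1, x.2.2)
  map_add' x y := by simp [mulVec_add]
  map_smul' c x := by simp [mulVec_smul]
  invFun x := (x.1, Rᵀ *ᵥ x.2.1, x.2.2)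
  left_inv x := by simp [h]
  right_inv x := by simp [mul_eq_one_comm.1 h]

theorem nullRotation_apply (R : Matrix (Fin m) (Fin m) ℝ) (h : Rᵀ * R = 1) (x : LSp m) :
    nullRotation R h x = (x.1, R *ᵥ x.2.1, x.2.2) := rfl

theorem mulVec_dotProduct_mulVec_of_orthogonal {R : Matrix (Fin m) (Fin m) ℝ} (h : Rᵀ * R = 1)
    (x y : Fin m → ℝ) : (R *ᵥ x) ⬝ᵥ (R *ᵥ y) = x ⬝ᵥ y := by
  rw [dotProduct_mulVec, vecMul_mulVec, dotProduct_comm, ← mulVec_transpose, transpose_mul,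
    transpose_transpose, h, one_mulVec, dotProduct_comm]

theorem nullRotation_isLIsometry (R : Matrix (Fin m) (Fin m) ℝ) (h : Rᵀ * R = 1) :
    IsLIsometry (nullRotation R h) := by
  intro x y
  simp only [nullRotation_apply, LForm_eq, mulVec_dotProduct_mulVec_of_orthogonal h]

theorem conj_eq_of_forall {ψ : LSp m ≃ₗ[ℝ] LSp m} {H K : LSp m →ₗ[ℝ] LSp m}
    (h : ∀ x, ψ (H x) = K (ψ x)) : ψ.conj H = K := by
  refine LinearMap.ext fun x => ?_
  rw [LinearEquiv.conj_apply_apply, h, LinearEquiv.apply_symm_apply]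

theorem conj_nullTranslation_stdLin (p : Fin m → ℝ) {a : ℝ} {A : Matrix (Fin m) (Fin m) ℝ}
    (hA : Aᵀ = -A) (u : Fin m → ℝ) :
    (nullTranslation p).conj (stdLin m (a, A, u))
      = stdLin m (a, A, u + (A *ᵥ p + a • p)) := by
  have h1 : ∀ x, (A *ᵥ p) ⬝ᵥ x = - (p ⬝ᵥ (A *ᵥ x)) := fun x => by
    rw [dotProduct_mulVec, ← mulVec_transpose, hA, neg_mulVec, neg_dotProduct, neg_neg]
  have h2 : p ⬝ᵥ (A *ᵥ p) = 0 := by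
    have := h1 p
    rw [dotProduct_comm] at this
    linarith
  refine conj_eq_of_forall fun x => ?_
  simp only [stdLin_apply, nullTranslation_apply]
  refine Prod.ext ?_ (Prod.ext ?_ ?_)
  · simp only [dotProduct_sub, dotProduct_add, add_dotProduct, dotProduct_smul, smul_dotProduct,
      smul_eq_mul, h1, h2]
    rw [dotProduct_comm p u]
    ring
  · simp only [mulVec_add, mulVec_smul, smul_add, neg_smul, smul_smul]
    rw [mul_comm a]
    abel
  · simp

theorem conj_nullRotation_stdLin (R : Matrix (Fin m) (Fin m) ℝ) (h : Rᵀ * R = 1) (a : ℝ)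
    (A : Matrix (Fin m) (Fin m) ℝ) (u : Fin m → ℝ) :
    (nullRotation R h).conj (stdLin m (a, A, u)) = stdLin m (a, R * A * Rᵀ, R *ᵥ u) := by
  refine conj_eq_of_forall fun x => ?_
  simp only [stdLin_apply, nullRotation_apply]
  refine Prod.ext ?_ (Prod.ext ?_ ?_)
  · simp only [mulVec_dotProduct_mulVec_of_orthogonal h]
  · simp only [mulVec_sub, mulVec_smul, mulVec_mulVec, Matrix.mul_assoc, h, Matrix.mul_one]
  · simp

/-- Every nonzero null vector is proportional to the image of `v` under an isometry. -/
theorem exists_isLIsometry_apply_eq_smul {x : LSp m} (hx : LForm x x = 0) :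
    ∃ ψ : LSp m ≃ₗ[ℝ] LSp m, IsLIsometry ψ ∧ ∃ c : ℝ, x = c • ψ (1, 0, 0) := by
  obtain ⟨α, z, β⟩ := x
  simp only [LForm_eq] at hx
  by_cases hβ : β = 0
  · subst hβ
    have hz : z = 0 := dotProduct_self_eq_zero.1 (by simpa using hx)
    subst hz
    exact ⟨LinearEquiv.refl ℝ _, fun _ _ => rfl, α, by simp⟩
  · refine ⟨(nullSwap m).trans (nullTranslation (β⁻¹ • z)), fun x y => ?_, β, ?_⟩
    · rw [LinearEquiv.trans_apply, LinearEquiv.trans_apply, nullTranslation_isLIsometry,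
        nullSwap_isLIsometry]
    · have : nullSwap m (1, 0, 0) = (0, 0, 1) := rfl
      rw [LinearEquiv.trans_apply, this, nullTranslation_apply]
      refine Prod.ext ?_ (Prod.ext ?_ ?_)
      · simp only [dotProduct_zero, smul_dotProduct, dotProduct_smul, smul_eq_mul, Prod.smul_fst]
        field_simp
        linarith
      · simp [smul_smul, hβ]
      · simp

/-- A skew endomorphism for which `v` is an eigenvector lies in `(ℝ ⊕ 𝔰𝔬(m)) ⋉ ℝ^m`. -/
theorem exists_eq_stdLin {H : LSp m →ₗ[ℝ] LSp m} (hH : ∀ x y, LForm (H x) y = - LForm x (H y))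
    {a : ℝ} (ha : H (1, 0, 0) = (a, 0, 0)) :
    ∃ (A : Matrix (Fin m) (Fin m) ℝ) (u : Fin m → ℝ), Aᵀ = -A ∧ H = stdLin m (a, A, u) := by
  set M : (Fin m → ℝ) →ₗ[ℝ] (Fin m → ℝ) :=
    LinearMap.fst ℝ _ _ ∘ₗ LinearMap.snd ℝ _ _ ∘ₗ H ∘ₗ LinearMap.inr ℝ _ _ ∘ₗ
      LinearMap.inl ℝ _ _ with hM
  set A := LinearMap.toMatrix' M with hA
  have hAz : ∀ z, A *ᵥ z = (H (0, z, 0)).2.1 := fun z => by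
    rw [hA, LinearMap.toMatrix'_mulVec]
    rfl
  set u : Fin m → ℝ := -(H (0, 0, 1)).2.1 with hu
  have hskewA : ∀ y z, (A *ᵥ y) ⬝ᵥ z = -(y ⬝ᵥ (A *ᵥ z)) := fun y z => by
    have := hH (0, y, 0) (0, z, 0)
    simpa [LForm_eq, hAz] using this
  have hz3 : ∀ z, (H (0, z, 0)).2.2 = 0 := fun z => by
    have := hH (1, 0, 0) (0, z, 0)
    rw [ha] at this
    simpa [LForm_eq] using this
  have hz1 : ∀ z, (H (0, z, 0)).1 = u ⬝ᵥ z := fun z => by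
    have := hH (0, z, 0) (0, 0, 1)
    simp only [LForm_eq] at this
    simpa [hu, dotProduct_comm z] using this
  have hw3 : (H (0, 0, 1)).2.2 = -a := by
    have := hH (1, 0, 0) (0, 0, 1)
    rw [ha] at this
    simp [LForm_eq] at this
    linarith
  have hw1 : (H (0, 0, 1)).1 = 0 := by
    have := hH (0, 0, 1) (0, 0, 1)
    simp [LForm_eq] at this
    linarith
  refine ⟨A, u, ?_, LinearMap.ext ?_⟩
  · ext i j
    have := hskewA (Pi.single i 1) (Pi.single j 1)
    simp at this
    simpa using this
  · rintro ⟨α, z, β⟩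
    have hdec : ((α, z, β) : LSp m) = α • (1, 0, 0) + ((0, z, 0) + β • (0, 0, 1)) := by simp
    rw [hdec, map_add, map_add, map_smul, map_smul, ha, ← hdec, stdLin_apply]
    refine Prod.ext ?_ (Prod.ext ?_ ?_)
    · simp [hz1, hw1, mul_comm]
    · simp [hAz, hu, sub_eq_add_neg]
    · simp [hz3, hw3, mul_comm]

end Lorentz

section WeaklyIrreducible

variable {m : ℕ}

/-- A Lie algebra of skew endomorphisms all of whose proper nonzero invariant subspaces are
degenerate. -/
structure IsWeaklyIrreducible (h : Submodule ℝ (LSp m →ₗ[ℝ] LSp m)) : Prop where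
  lie : ∀ H ∈ h, ∀ K ∈ h, H * K - K * H ∈ h
  skew : ∀ H ∈ h, ∀ x y : LSp m, LForm (H x) y = - LForm x (H y)
  degenerate : ∀ W : Submodule ℝ (LSp m), (∀ H ∈ h, ∀ x ∈ W, H x ∈ W) →
    W ≠ ⊥ → W ≠ ⊤ → ∃ x ∈ W, x ≠ 0 ∧ ∀ y ∈ W, LForm x y = 0

/-- The conjugate `ψ⁻¹ ∘ 𝔥 ∘ ψ` as a subspace. -/
def conjSubmodule (ψ : LSp m ≃ₗ[ℝ] LSp m) (h : Submodule ℝ (LSp m →ₗ[ℝ] LSp m)) :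
    Submodule ℝ (LSp m →ₗ[ℝ] LSp m) :=
  h.comap ψ.conj.toLinearMap

theorem mem_conjSubmodule {ψ : LSp m ≃ₗ[ℝ] LSp m} {h : Submodule ℝ (LSp m →ₗ[ℝ] LSp m)}
    {H : LSp m →ₗ[ℝ] LSp m} : H ∈ conjSubmodule ψ h ↔ ψ.conj H ∈ h := Iff.rfl

theorem conjSubmodule_conjSubmodule (φ ψ : LSp m ≃ₗ[ℝ] LSp m)
    (h : Submodule ℝ (LSp m →ₗ[ℝ] LSp m)) :
    conjSubmodule φ (conjSubmodule ψ h) = conjSubmodule (φ.trans ψ) h := rfl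

theorem conjSet_eq_coe_conjSubmodule (φ : LSp m ≃ₗ[ℝ] LSp m)
    (h : Submodule ℝ (LSp m →ₗ[ℝ] LSp m)) :
    conjSet m φ h = (conjSubmodule φ h : Set (LSp m →ₗ[ℝ] LSp m)) := by
  ext H
  refine ⟨?_, fun hH => ⟨φ.conj H, hH, ?_⟩⟩
  · rintro ⟨K, hK, rfl⟩
    rw [SetLike.mem_coe, mem_conjSubmodule]
    have : φ.conj (φ.symm.toLinearMap ∘ₗ K ∘ₗ φ.toLinearMap) = K :=
      conj_eq_of_forall fun x => by simp
    rwa [this]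
  · ext x <;> simp [LinearEquiv.conj_apply_apply]

theorem IsWeaklyIrreducible.conj {h : Submodule ℝ (LSp m →ₗ[ℝ] LSp m)}
    (hh : IsWeaklyIrreducible h) {ψ : LSp m ≃ₗ[ℝ] LSp m} (hψ : IsLIsometry ψ) :
    IsWeaklyIrreducible (conjSubmodule ψ h) where
  lie H hH K hK := by
    rw [mem_conjSubmodule] at *
    have := hh.lie _ hH _ hK
    have h2 : ψ.conj (H * K - K * H) = ψ.conj H * ψ.conj K - ψ.conj K * ψ.conj H :=
      conj_eq_of_forall fun x => by simp [LinearEquiv.conj_apply_apply]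
    rwa [h2]
  skew H hH x y := by
    have := hh.skew _ (mem_conjSubmodule.1 hH) (ψ x) (ψ y)
    simpa only [LinearEquiv.conj_apply_apply, LinearEquiv.symm_apply_apply, hψ _ _] using this
  degenerate W hW hbot htop := by
    obtain ⟨x, hx, hx0, hxW⟩ := hh.degenerate (W.map ψ.toLinearMap) (by
      rintro H hH _ ⟨x, hx, rfl⟩
      have : ψ.conj (ψ.symm.conj H) = H := conj_eq_of_forall fun x => by
        simp [LinearEquiv.conj_apply_apply]
      refine ⟨ψ.symm.conj H x, hW _ (by rwa [mem_conjSubmodule, this]) x hx, ?_⟩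
      simp [LinearEquiv.conj_apply_apply])
      (fun h0 => hbot ((Submodule.map_eq_bot_iff (e := ψ)).1 h0))
      (fun h0 => htop ((Submodule.map_eq_top_iff (e := ψ)).1 h0))
    obtain ⟨x, hx, rfl⟩ := hx
    refine ⟨x, hx, fun h0 => hx0 (by simp [h0]), fun y hy => ?_⟩
    rw [← hψ]
    exact hxW _ ⟨y, hy, rfl⟩

/-- A weakly irreducible but not irreducible algebra stabilizes a null line. -/
theorem IsWeaklyIrreducible.exists_conj_stabilizer {h : Submodule ℝ (LSp m →ₗ[ℝ] LSp m)}
    (hh : IsWeaklyIrreducible h) (hnonirr : ∃ W : Submodule ℝ (LSp m), W ≠ ⊥ ∧ W ≠ ⊤ ∧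
      ∀ H ∈ h, ∀ x ∈ W, H x ∈ W) :
    ∃ ψ : LSp m ≃ₗ[ℝ] LSp m, IsLIsometry ψ ∧ ∀ H ∈ conjSubmodule ψ h,
      ∃ (a : ℝ) (A : Matrix (Fin m) (Fin m) ℝ) (u : Fin m → ℝ),
        Aᵀ = -A ∧ H = stdLin m (a, A, u) := by
  obtain ⟨W, hbot, htop, hW⟩ := hnonirr
  obtain ⟨x, hx, hx0, hxW⟩ := hh.degenerate W hW hbot htop
  obtain ⟨ψ, hψ, c, hc⟩ := exists_isLIsometry_apply_eq_smul (hxW x hx)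
  refine ⟨ψ, hψ, fun H hH => ?_⟩
  have hc0 : c ≠ 0 := by
    rintro rfl
    exact hx0 (by simpa using hc)
  have hv : ψ (1, 0, 0) = c⁻¹ • x := by rw [hc, smul_smul, inv_mul_cancel₀ hc0, one_smul]
  have hHv : ψ (H (1, 0, 0)) = c⁻¹ • ψ.conj H x := by
    rw [← map_smul, ← hv, LinearEquiv.conj_apply_apply, LinearEquiv.symm_apply_apply]
  rw [mem_conjSubmodule] at hH
  have hHx := hW _ hH x hx
  have h1 : LForm (1, 0, 0) (H (1, 0, 0)) = 0 := by
    rw [← hψ, hv, hHv, LForm_smul_smul, hxW _ hHx, mul_zero]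
  have h2 : LForm (H (1, 0, 0)) (H (1, 0, 0)) = 0 := by
    rw [← hψ, hHv]
    have h3 := hh.skew _ hH x (ψ.conj H x)
    rw [hxW _ (hW _ hH _ hHx), neg_zero] at h3
    rw [LForm_smul_smul, h3, mul_zero]
  have ha : H (1, 0, 0) = ((H (1, 0, 0)).1, 0, 0) := by
    generalize H (1, 0, 0) = y at h1 h2
    obtain ⟨α, z, β⟩ := y
    simp only [LForm_eq] at h1 h2
    obtain rfl : β = 0 := by simpa using h1
    have hz : z = 0 := dotProduct_self_eq_zero.1 (by simpa using h2)
    rw [hz]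
  obtain ⟨A, u, hA, hH'⟩ := exists_eq_stdLin ((hh.conj hψ).skew H (mem_conjSubmodule.2 hH)) ha
  exact ⟨_, A, u, hA, hH'⟩

/-- The translation part of an algebra contained in `(ℝ ⊕ 𝔰𝔬(m)) ⋉ ℝ^m`. -/
noncomputable def translationPart (h : Submodule ℝ (LSp m →ₗ[ℝ] LSp m)) : Submodule ℝ (Fin m → ℝ) :=
  h.comap (stdLin m ∘ₗ LinearMap.inr ℝ _ _ ∘ₗ LinearMap.inr ℝ _ _)

theorem mem_translationPart {h : Submodule ℝ (LSp m →ₗ[ℝ] LSp m)} {u : Fin m → ℝ} :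
    u ∈ translationPart h ↔ stdLin m (0, 0, u) ∈ h := Iff.rfl

theorem translationPart_conj_nullRotation {h : Submodule ℝ (LSp m →ₗ[ℝ] LSp m)}
    {R : Matrix (Fin m) (Fin m) ℝ} {u : Fin m → ℝ} (hR : Rᵀ * R = 1) :
    u ∈ translationPart (conjSubmodule (nullRotation R hR) h) ↔ R *ᵥ u ∈ translationPart h := by
  rw [mem_translationPart, mem_conjSubmodule, conj_nullRotation_stdLin, Matrix.mul_zero,
    Matrix.zero_mul, mem_translationPart]

/-- A weakly irreducible algebra contained in `(ℝ ⊕ 𝔰𝔬(m)) ⋉ ℝ^m`. -/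
structure IsStabilizing (h : Submodule ℝ (LSp m →ₗ[ℝ] LSp m)) : Prop
    extends IsWeaklyIrreducible h where
  exists_std : ∀ H ∈ h, ∃ (a : ℝ) (A : Matrix (Fin m) (Fin m) ℝ) (u : Fin m → ℝ),
    Aᵀ = -A ∧ H = stdLin m (a, A, u)

namespace IsStabilizing

variable {h : Submodule ℝ (LSp m →ₗ[ℝ] LSp m)} {a b : ℝ} {A B : Matrix (Fin m) (Fin m) ℝ}
  {u v : Fin m → ℝ}

theorem transpose_eq (hh : IsStabilizing h) (hX : stdLin m (a, A, u) ∈ h) : Aᵀ = -A := by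
  obtain ⟨a', A', u', hA', he⟩ := hh.exists_std _ hX
  have := stdLin_injective he
  simp only [Prod.mk.injEq] at this
  rw [this.2.1, hA']

theorem commutator_mem (hh : IsStabilizing h) (hX : stdLin m (a, A, u) ∈ h)
    (hY : stdLin m (b, B, v) ∈ h) :
    stdLin m (0, A * B - B * A, (A *ᵥ v + a • v) - (B *ᵥ u + b • u)) ∈ h := by
  rw [← stdLin_commutator (hh.transpose_eq hX) (hh.transpose_eq hY)]
  exact hh.lie _ hX _ hY

/-- Definite invariant subspaces of the span of the `eᵢ` vanish. -/
theorem eq_bot_of_invariant (hh : IsStabilizing h) {N : Submodule ℝ (Fin m → ℝ)}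
    (hN : ∀ a A u, stdLin m (a, A, u) ∈ h → ∀ x ∈ N, u ⬝ᵥ x = 0 ∧ A *ᵥ x ∈ N) : N = ⊥ := by
  let ι : (Fin m → ℝ) →ₗ[ℝ] LSp m := LinearMap.inr ℝ _ _ ∘ₗ LinearMap.inl ℝ _ _
  have hι : ∀ x, ι x = (0, x, 0) := fun _ => rfl
  by_contra hne
  obtain ⟨z, hz, hz0⟩ := Submodule.exists_mem_ne_zero_of_ne_bot hne
  obtain ⟨_, ⟨x, hx, rfl⟩, hx0, hxN⟩ := hh.degenerate (N.map ι) (by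
    rintro H hH _ ⟨x, hx, rfl⟩
    obtain ⟨a, A, u, -, rfl⟩ := hh.exists_std H hH
    obtain ⟨h1, h2⟩ := hN a A u hH x hx
    exact ⟨A *ᵥ x, h2, by simp [stdLin_apply, hι, h1]⟩)
    (fun h0 => hz0 (by
      have : ι z ∈ N.map ι := ⟨z, hz, rfl⟩
      rw [h0, Submodule.mem_bot] at this
      simpa [hι] using this))
    (fun h0 => by
      have : ((1, 0, 0) : LSp m) ∈ N.map ι := h0 ▸ Submodule.mem_top
      obtain ⟨y, -, hy⟩ := this
      simpa [hι] using congrArg Prod.fst hy)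
  have := hxN _ ⟨x, hx, rfl⟩
  have hx0' : x = 0 := dotProduct_self_eq_zero.1 (by simpa [hι, LForm_eq] using this)
  exact hx0 (by rw [hx0', map_zero])

theorem conj_nullTranslation (hh : IsStabilizing h) (p : Fin m → ℝ) :
    IsStabilizing (conjSubmodule (nullTranslation p) h) where
  toIsWeaklyIrreducible := hh.toIsWeaklyIrreducible.conj (nullTranslation_isLIsometry p)
  exists_std H hH := by
    obtain ⟨a, A, u, hA, he⟩ := hh.exists_std _ (mem_conjSubmodule.1 hH)
    refine ⟨a, A, u - (A *ᵥ p + a • p), hA, (nullTranslation p).conj.injective ?_⟩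
    rw [he, conj_nullTranslation_stdLin p hA, sub_add_cancel]

theorem mem_conj_nullTranslation (hh : IsStabilizing h) {p : Fin m → ℝ} :
    stdLin m (a, A, u) ∈ conjSubmodule (nullTranslation p) h ↔
      stdLin m (a, A, u + (A *ᵥ p + a • p)) ∈ h := by
  constructor
  · intro hX
    rwa [← conj_nullTranslation_stdLin p ((hh.conj_nullTranslation p).transpose_eq hX)]
  · intro hX
    rwa [mem_conjSubmodule, conj_nullTranslation_stdLin p (hh.transpose_eq hX)]

theorem conj_nullRotation (hh : IsStabilizing h) {R : Matrix (Fin m) (Fin m) ℝ}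
    (hR : Rᵀ * R = 1) : IsStabilizing (conjSubmodule (nullRotation R hR) h) where
  toIsWeaklyIrreducible := hh.toIsWeaklyIrreducible.conj (nullRotation_isLIsometry R hR)
  exists_std H hH := by
    obtain ⟨a, A, u, hA, he⟩ := hh.exists_std _ (mem_conjSubmodule.1 hH)
    have hR' := mul_eq_one_comm.1 hR
    refine ⟨a, Rᵀ * A * R, Rᵀ *ᵥ u, ?_, (nullRotation R hR).conj.injective ?_⟩
    · simp [transpose_mul, hA, Matrix.mul_assoc]
    · rw [he, conj_nullRotation_stdLin, mulVec_mulVec, hR', one_mulVec]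
      congr 3
      calc A = (R * Rᵀ) * A * (R * Rᵀ) := by simp [hR']
        _ = R * (Rᵀ * A * R) * Rᵀ := by simp only [Matrix.mul_assoc]

theorem translationPart_conj_nullTranslation (hh : IsStabilizing h) (p : Fin m → ℝ) :
    translationPart (conjSubmodule (nullTranslation p) h) = translationPart h := by
  ext u
  rw [mem_translationPart, hh.mem_conj_nullTranslation, mem_translationPart]
  simp

end IsStabilizing

/-- Every subspace of `ℝ^m` is the image of a coordinate subspace under a rotation. -/
theorem exists_orthogonal_mulVec_mem_iff (T : Submodule ℝ (Fin m → ℝ)) :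
    ∃ (R : Matrix (Fin m) (Fin m) ℝ) (ℓ : ℕ), Rᵀ * R = 1 ∧ ℓ ≤ m ∧
      ∀ z, R *ᵥ z ∈ T ↔ ∀ i : Fin m, ℓ ≤ (i : ℕ) → z i = 0 := by
  let e := WithLp.linearEquiv 2 ℝ (Fin m → ℝ)
  let T' : Submodule ℝ (EuclideanSpace ℝ (Fin m)) := T.comap e.toLinearMap
  let c := stdOrthonormalBasis ℝ T'
  set ℓ := Module.finrank ℝ T' with hℓ
  have hle : ℓ ≤ m := by
    have := Submodule.finrank_le T'
    rwa [finrank_euclideanSpace_fin] at this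
  obtain ⟨b, hb⟩ := Orthonormal.exists_orthonormalBasis_extension_of_card_eq
    (𝕜 := ℝ) (E := EuclideanSpace ℝ (Fin m)) (ι := Fin m) (by simp)
    (v := fun i => if hi : (i : ℕ) < ℓ then (c ⟨i, hi⟩ : EuclideanSpace ℝ (Fin m)) else 0)
    (s := {i | (i : ℕ) < ℓ}) (by
      rw [orthonormal_iff_ite]
      rintro ⟨i, hi⟩ ⟨j, hj⟩
      simp only [Set.mem_ofPred_eq] at hi hj
      have := orthonormal_iff_ite.1 c.orthonormal ⟨i, hi⟩ ⟨j, hj⟩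
      simpa [hi, hj, Fin.ext_iff] using this)
  have hbT : ∀ i : Fin m, (i : ℕ) < ℓ → b i ∈ T' := fun i hi => by
    rw [hb i hi, dif_pos hi]
    exact (c ⟨i, hi⟩).2
  let R : Matrix (Fin m) (Fin m) ℝ := Matrix.of fun i j => b j i
  have hRz : ∀ z : Fin m → ℝ, R *ᵥ z = e (∑ j, z j • b j) := fun z => by
    ext i
    simp [e, R, mulVec, dotProduct, mul_comm]
  have hinner : ∀ j (z : Fin m → ℝ), inner ℝ (b j) (∑ k, z k • b k) = z j := fun j z => by
    rw [inner_sum]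
    simp [inner_smul_right, orthonormal_iff_ite.1 b.orthonormal]
  refine ⟨R, ℓ, ?_, hle, fun z => ?_⟩
  · ext i j
    have := orthonormal_iff_ite.1 b.orthonormal i j
    rw [Matrix.one_apply, ← this]
    simp [R, Matrix.mul_apply, PiLp.inner_apply, mul_comm]
  · rw [hRz]
    change (∑ j, z j • b j) ∈ T' ↔ _
    constructor
    · intro hz i hi
      have horth : ∀ y ∈ T', inner ℝ (b i) y = 0 := by
        intro y hy
        have hy' := congrArg (Subtype.val) (c.sum_repr ⟨y, hy⟩)
        simp only [Submodule.coe_sum, Submodule.coe_smul] at hy'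
        rw [← hy', inner_sum]
        refine Finset.sum_eq_zero fun k _ => ?_
        have hk : (c k : EuclideanSpace ℝ (Fin m)) = b ⟨k, k.2.trans_le hle⟩ := by
          rw [hb _ (show (k : ℕ) < ℓ from k.2), dif_pos (show (k : ℕ) < ℓ from k.2)]
        rw [inner_smul_right, hk, orthonormal_iff_ite.1 b.orthonormal, if_neg, mul_zero]
        intro h0
        have := congrArg Fin.val h0
        have hk2 := k.2
        simp only at this
        omega
      rw [← hinner i z, horth _ hz]
    · intro hz
      refine Submodule.sum_mem _ fun j _ => ?_
      by_cases hj : (j : ℕ) < ℓ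
      · exact T'.smul_mem _ (hbT j hj)
      · rw [hz j (not_lt.1 hj), zero_smul]
        exact T'.zero_mem

end WeaklyIrreducible

section Classification

variable {m : ℕ}

/-- The subspace of `ℝ^m` annihilated by the action of an algebra contained in
`(ℝ ⊕ 𝔰𝔬(m)) ⋉ ℝ^m`. -/
noncomputable def invariantPart (h : Submodule ℝ (LSp m →ₗ[ℝ] LSp m)) :
    Submodule ℝ (Fin m → ℝ) where
  carrier := {w | ∀ a A u, stdLin m (a, A, u) ∈ h → A *ᵥ w + a • w = 0}
  add_mem' {x y} hx hy a A u hX := by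
    rw [mulVec_add, smul_add, add_add_add_comm, hx a A u hX, hy a A u hX, add_zero]
  zero_mem' a A u _ := by simp
  smul_mem' c x hx a A u hX := by
    rw [mulVec_smul, smul_comm a c, ← smul_add, hx a A u hX, smul_zero]

/-- The part of `u` in the last `m - ℓ` coordinates. -/
def tailPart (ℓ : ℕ) (u : Fin m → ℝ) : Fin m → ℝ := fun i => if (i : ℕ) < ℓ then 0 else u i

theorem tailPart_apply_of_lt {ℓ : ℕ} (u : Fin m → ℝ) {i : Fin m} (hi : (i : ℕ) < ℓ) :
    tailPart ℓ u i = 0 := if_pos hi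

theorem tailPart_apply_of_le {ℓ : ℕ} (u : Fin m → ℝ) {i : Fin m} (hi : ℓ ≤ (i : ℕ)) :
    tailPart ℓ u i = u i := if_neg (not_lt.2 hi)

/-- The bilinear form `(a, A), (b, B) ↦ ab + tr(Aᵀ B)`. -/
noncomputable def linearPartForm (m : ℕ) : (ℝ × Matrix (Fin m) (Fin m) ℝ × (Fin m → ℝ)) →ₗ[ℝ]
    (ℝ × Matrix (Fin m) (Fin m) ℝ × (Fin m → ℝ)) →ₗ[ℝ] ℝ :=
  LinearMap.mk₂ ℝ (fun X Y => X.1 * Y.1 + (X.2.1ᵀ * Y.2.1).trace)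
    (fun X Y Z => by simp [Matrix.add_mul]; ring)
    (fun c X Y => by simp; ring)
    (fun X Y Z => by simp [Matrix.mul_add]; ring)
    (fun c X Y => by simp; ring)

theorem linearPartForm_apply (X Y : ℝ × Matrix (Fin m) (Fin m) ℝ × (Fin m → ℝ)) :
    linearPartForm m X Y = X.1 * Y.1 + (X.2.1ᵀ * Y.2.1).trace := rfl

namespace IsStabilizing

variable {h : Submodule ℝ (LSp m →ₗ[ℝ] LSp m)} {a b : ℝ} {A B : Matrix (Fin m) (Fin m) ℝ}
  {u v t : Fin m → ℝ} {ℓ : ℕ}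

theorem mulVec_mem_translationPart (hh : IsStabilizing h) (hX : stdLin m (a, A, u) ∈ h)
    (ht : t ∈ translationPart h) : A *ᵥ t ∈ translationPart h := by
  have h1 := hh.commutator_mem hX (mem_translationPart.1 ht)
  simp only [Matrix.mul_zero, Matrix.zero_mul, sub_zero, zero_mulVec, zero_smul, add_zero] at h1
  have h2 := (translationPart h).sub_mem (mem_translationPart.2 h1)
    ((translationPart h).smul_mem a ht)
  rwa [add_sub_cancel_right] at h2

theorem stdLin_add_mem (hX : stdLin m (a, A, u) ∈ h) (ht : t ∈ translationPart h) :
    stdLin m (a, A, u + t) ∈ h := by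
  have : ((a, A, u + t) : ℝ × Matrix (Fin m) (Fin m) ℝ × (Fin m → ℝ)) = (a, A, u) + (0, 0, t) := by
    simp
  rw [this, map_add]
  exact h.add_mem hX ht

theorem mulVec_apply_eq_zero (hh : IsStabilizing h)
    (hT : ∀ z, z ∈ translationPart h ↔ ∀ i : Fin m, ℓ ≤ (i : ℕ) → z i = 0)
    (hX : stdLin m (a, A, u) ∈ h) {x : Fin m → ℝ} (hx : ∀ i : Fin m, (i : ℕ) < ℓ → x i = 0)
    {i : Fin m} (hi : (i : ℕ) < ℓ) : (A *ᵥ x) i = 0 := by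
  change ∑ j, A i j * x j = 0
  refine Finset.sum_eq_zero fun j _ => ?_
  rcases lt_or_ge (j : ℕ) ℓ with hj | hj
  · rw [hx j hj, mul_zero]
  · have h1 : Pi.single i 1 ∈ translationPart h := (hT _).2 fun k hk => by
      rw [Pi.single_eq_of_ne]
      rintro rfl
      omega
    have h2 := (hT _).1 (hh.mulVec_mem_translationPart hX h1) j hj
    have h3 := congrFun (congrFun (hh.transpose_eq hX) i) j
    simp only [mulVec_single_one, col_apply] at h2
    rw [transpose_apply, neg_apply, h2] at h3
    rw [neg_eq_zero.1 h3.symm, zero_mul]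

theorem sub_tailPart_mem
    (hT : ∀ z, z ∈ translationPart h ↔ ∀ i : Fin m, ℓ ≤ (i : ℕ) → z i = 0) (u : Fin m → ℝ) :
    u - tailPart ℓ u ∈ translationPart h :=
  (hT _).2 fun i hi => by rw [Pi.sub_apply, tailPart_apply_of_le u hi, sub_self]

theorem tailPart_mem (hT : ∀ z, z ∈ translationPart h ↔ ∀ i : Fin m, ℓ ≤ (i : ℕ) → z i = 0)
    (hX : stdLin m (a, A, u) ∈ h) : stdLin m (a, A, tailPart ℓ u) ∈ h := by
  have := stdLin_add_mem hX ((translationPart h).neg_mem (sub_tailPart_mem hT u))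
  rwa [neg_sub, add_sub_cancel] at this

/-- Up to a null translation, the translational components are sums of translations contained in
the algebra and of invariant vectors. -/
theorem exists_tailPart_sub_mem_invariantPart (hh : IsStabilizing h)
    (hT : ∀ z, z ∈ translationPart h ↔ ∀ i : Fin m, ℓ ≤ (i : ℕ) → z i = 0) :
    ∃ p, ∀ a A u, stdLin m (a, A, u) ∈ h →
      tailPart ℓ u - (A *ᵥ p + a • p) ∈ invariantPart h := by
  let L : Submodule ℝ (ℝ × Matrix (Fin m) (Fin m) ℝ × (Fin m → ℝ)) :=
    { carrier := {X | stdLin m X ∈ h ∧ ∀ i : Fin m, (i : ℕ) < ℓ → X.2.2 i = 0}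
      add_mem' := fun {X Y} hX hY => ⟨by rw [map_add]; exact h.add_mem hX.1 hY.1,
        fun i hi => by simp [hX.2 i hi, hY.2 i hi]⟩
      zero_mem' := ⟨by rw [map_zero]; exact h.zero_mem, fun i _ => rfl⟩
      smul_mem' := fun c X hX => ⟨by rw [map_smul]; exact h.smul_mem c hX.1,
        fun i hi => by simp [hX.2 i hi]⟩ }
  let ρ : L →ₗ[ℝ] Matrix (Fin m) (Fin m) ℝ :=
    (LinearMap.fst ℝ _ _ ∘ₗ LinearMap.snd ℝ _ _ +
      (LinearMap.toSpanSingleton ℝ _ 1) ∘ₗ LinearMap.fst ℝ _ _) ∘ₗ L.subtype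
  have hρ : ∀ X : L, ρ X = X.1.2.1 + X.1.1 • 1 := fun X => rfl
  have hρv : ∀ (X : L) z, ρ X *ᵥ z = X.1.2.1 *ᵥ z + X.1.1 • z := fun X z => by
    rw [hρ, add_mulVec, smul_mulVec, one_mulVec]
  let U : L →ₗ[ℝ] (Fin m → ℝ) := LinearMap.snd ℝ _ _ ∘ₗ LinearMap.snd ℝ _ _ ∘ₗ L.subtype
  have hU : ∀ X : L, U X = X.1.2.2 := fun X => rfl
  have htr : ∀ X : L, X.1.2.1ᵀ = -X.1.2.1 := fun X => hh.transpose_eq X.2.1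
  let br : L → L → L := fun Y X =>
    ⟨(0, Y.1.2.1 * X.1.2.1 - X.1.2.1 * Y.1.2.1,
      (Y.1.2.1 *ᵥ X.1.2.2 + Y.1.1 • X.1.2.2) - (X.1.2.1 *ᵥ Y.1.2.2 + X.1.1 • Y.1.2.2)),
      hh.commutator_mem Y.2.1 X.2.1, fun i hi => by
        simp only [Pi.sub_apply, Pi.add_apply, Pi.smul_apply,
          hh.mulVec_apply_eq_zero hT Y.2.1 X.2.2 hi, hh.mulVec_apply_eq_zero hT X.2.1 Y.2.2 hi,
          X.2.2 i hi, Y.2.2 i hi, smul_zero, add_zero, sub_zero]⟩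
  have hbr1 : ∀ Y X, (br Y X).1.1 = 0 := fun _ _ => rfl
  have hbr2 : ∀ Y X, (br Y X).1.2.1 = Y.1.2.1 * X.1.2.1 - X.1.2.1 * Y.1.2.1 := fun _ _ => rfl
  obtain ⟨p, hp⟩ := exists_sub_coboundary_invariant
    ((linearPartForm m).compl₁₂ L.subtype L.subtype) (fun X Y => by
      simp only [LinearMap.compl₁₂_apply, Submodule.subtype_apply, linearPartForm_apply]
      rw [← trace_transpose (X.1.2.1ᵀ * Y.1.2.1), transpose_mul, transpose_transpose, mul_comm])
    (fun X hX => by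
      simp only [LinearMap.compl₁₂_apply, Submodule.subtype_apply, linearPartForm_apply]
      have h0 : 0 ≤ (X.1.2.1ᵀ * X.1.2.1).trace :=
        Finset.sum_nonneg fun i _ => by
          rw [diag_apply, Matrix.mul_apply]
          exact Finset.sum_nonneg fun j _ => mul_self_nonneg (X.1.2.1 j i)
      refine lt_of_le_of_ne (add_nonneg (mul_self_nonneg _) h0) fun h1 => hX ?_
      have hA : X.1.2.1 = 0 := by
        rw [← Matrix.trace_conjTranspose_mul_self_eq_zero_iff, conjTranspose_eq_transpose_of_trivial]
        nlinarith [mul_self_nonneg X.1.1]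
      have ha : X.1.1 = 0 := by
        refine mul_self_eq_zero.1 ?_
        nlinarith [mul_self_nonneg X.1.1]
      obtain ⟨⟨a, A, u⟩, hXh, hXu⟩ := X
      obtain rfl : a = 0 := ha
      obtain rfl : A = 0 := hA
      have hu : u = 0 := by
        ext i
        rcases lt_or_ge (i : ℕ) ℓ with hi | hi
        · exact hXu i hi
        · exact (hT u).1 hXh i hi
      subst hu
      rfl) br (fun X Y Z => by
      simp only [LinearMap.compl₁₂_apply, Submodule.subtype_apply, linearPartForm_apply, hbr1, hbr2,
        transpose_sub, transpose_mul, htr, zero_mul, mul_zero, zero_add]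
      simp only [Matrix.neg_mul, Matrix.mul_neg, neg_neg, Matrix.sub_mul, Matrix.mul_sub,
        trace_sub, trace_neg, ← Matrix.mul_assoc]
      rw [Matrix.trace_mul_cycle Y.1.2.1 X.1.2.1 Z.1.2.1, Matrix.trace_mul_cycle Z.1.2.1]
      ring)
    ρ (fun X Y => by
      rw [hρ (br Y X), hbr1, hbr2, hρ, hρ]
      simp only [Matrix.add_mul, Matrix.mul_add, Matrix.smul_mul, Matrix.mul_smul, Matrix.one_mul,
        Matrix.mul_one, zero_smul, add_zero, smul_add]
      rw [smul_comm X.1.1 Y.1.1]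
      abel)
    (fun X Y => by
      rw [hρ (br Y X), hbr1, hbr2, hρ, hρ]
      simp only [transpose_add, transpose_sub, transpose_smul, transpose_mul, transpose_one, htr,
        Matrix.add_mul, Matrix.mul_add, Matrix.smul_mul, Matrix.mul_smul, Matrix.one_mul,
        Matrix.mul_one, zero_smul, add_zero, Matrix.mul_neg, Matrix.neg_mul, neg_neg, smul_neg, smul_add]
      rw [smul_comm X.1.1 Y.1.1]
      abel)
    U (fun X Y => by rw [hρv, hρv]; rfl)
  refine ⟨p, fun a A u hX b B v hY => ?_⟩
  have := hp ⟨(b, B, tailPart ℓ v), tailPart_mem hT hY, fun i hi => tailPart_apply_of_lt v hi⟩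
    ⟨(a, A, tailPart ℓ u), tailPart_mem hT hX, fun i hi => tailPart_apply_of_lt u hi⟩
  rwa [hρv, hρv, hU] at this

/-- Weak irreducibility forces `ℝ^m` to be spanned by translations and invariant vectors as soon
as all translational components are. -/
theorem sup_eq_top (hh : IsStabilizing h)
    (hu : ∀ a A u, stdLin m (a, A, u) ∈ h → u ∈ translationPart h ⊔ invariantPart h) :
    translationPart h ⊔ invariantPart h = ⊤ := by
  refine eq_top_of_dotPerp_eq_bot (hh.eq_bot_of_invariant fun a A u hX x hx => ?_)
  refine ⟨hx u (hu a A u hX), fun q hq => ?_⟩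
  have hAq : A *ᵥ q ∈ translationPart h ⊔ invariantPart h := by
    obtain ⟨t, ht, k, hk, rfl⟩ := Submodule.mem_sup.1 hq
    rw [mulVec_add, eq_neg_of_add_eq_zero_left (hk a A u hX)]
    exact Submodule.add_mem_sup (hh.mulVec_mem_translationPart hX ht)
      (Submodule.neg_mem _ (Submodule.smul_mem _ a hk))
  have := hx _ hAq
  rwa [← neg_eq_zero, ← neg_dotProduct, ← neg_mulVec, ← hh.transpose_eq hX, mulVec_transpose,
    ← dotProduct_mulVec] at this

end IsStabilizing


/-- The normal form of a weakly irreducible algebra stabilizing the null line `ℝv`. -/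
structure IsNormalized (h : Submodule ℝ (LSp m →ₗ[ℝ] LSp m)) (ℓ : ℕ) : Prop
    extends IsStabilizing h where
  le : ℓ ≤ m
  mem_iff : ∀ z, z ∈ translationPart h ↔ ∀ i : Fin m, ℓ ≤ (i : ℕ) → z i = 0
  sup_eq_top : translationPart h ⊔ invariantPart h = ⊤

theorem IsStabilizing.exists_isNormalized {h : Submodule ℝ (LSp m →ₗ[ℝ] LSp m)}
    (hh : IsStabilizing h) :
    ∃ φ : LSp m ≃ₗ[ℝ] LSp m, IsLIsometry φ ∧ ∃ ℓ, IsNormalized (conjSubmodule φ h) ℓ := by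
  obtain ⟨R, ℓ, hR, hℓ, hRT⟩ := exists_orthogonal_mulVec_mem_iff (translationPart h)
  have h1 := hh.conj_nullRotation hR
  have hT1 : ∀ z, z ∈ translationPart (conjSubmodule (nullRotation R hR) h) ↔
      ∀ i : Fin m, ℓ ≤ (i : ℕ) → z i = 0 := fun z => by
    rw [translationPart_conj_nullRotation, hRT]
  obtain ⟨p, hp⟩ := h1.exists_tailPart_sub_mem_invariantPart hT1
  refine ⟨(nullTranslation p).trans (nullRotation R hR), fun x y => ?_, ℓ, ?_⟩
  · rw [LinearEquiv.trans_apply, LinearEquiv.trans_apply, nullRotation_isLIsometry,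
      nullTranslation_isLIsometry]
  · rw [← conjSubmodule_conjSubmodule]
    have h2 := h1.conj_nullTranslation p
    have hT2 := h1.translationPart_conj_nullTranslation p
    refine ⟨h2, hℓ, by rwa [hT2], h2.sup_eq_top fun a A u hX => ?_⟩
    rw [h1.mem_conj_nullTranslation] at hX
    have ht := IsStabilizing.sub_tailPart_mem hT1 (u + (A *ᵥ p + a • p))
    have hk := hp _ _ _ hX
    rw [hT2]
    have hk' : tailPart ℓ (u + (A *ᵥ p + a • p)) - (A *ᵥ p + a • p) ∈
        invariantPart (conjSubmodule (nullTranslation p) (conjSubmodule (nullRotation R hR) h)) :=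
      fun b B v hY => hk b B _ (h1.mem_conj_nullTranslation.1 hY)
    have := Submodule.add_mem_sup ht hk'
    rwa [sub_add_sub_cancel, add_sub_cancel_right] at this

theorem mem_gProj {h : Submodule ℝ (LSp m →ₗ[ℝ] LSp m)} {A : Matrix (Fin m) (Fin m) ℝ} :
    A ∈ gProj m (h : Set (LSp m →ₗ[ℝ] LSp m)) ↔ ∃ a u, stdLin m (a, A, u) ∈ h := by
  constructor
  · rintro ⟨H, hH, a, u, he⟩
    exact ⟨a, u, coe_eq_stdFun_iff.1 he ▸ hH⟩
  · rintro ⟨a, u, hX⟩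
    exact ⟨_, hX, a, u, rfl⟩

/-- The set of endomorphisms `S` lies in `(ℝ ⊕ 𝔰𝔬(m)) ⋉ ℝ^m` and is of one of the four types of
the classification. -/
def IsStandardType (m : ℕ) (S : Set (LSp m →ₗ[ℝ] LSp m)) : Prop :=
  (∀ H ∈ S, ∃ (a : ℝ) (A : Matrix (Fin m) (Fin m) ℝ)
    (u : Fin m → ℝ), Aᵀ = -A ∧ ⇑H = stdFun m a A u) ∧
  ((∀ H : LSp m →ₗ[ℝ] LSp m, H ∈ S ↔
      ∃ (a : ℝ) (A : Matrix (Fin m) (Fin m) ℝ) (u : Fin m → ℝ),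
        A ∈ gProj m S ∧ ⇑H = stdFun m a A u) ∨
   (∀ H : LSp m →ₗ[ℝ] LSp m, H ∈ S ↔
      ∃ (A : Matrix (Fin m) (Fin m) ℝ) (u : Fin m → ℝ),
        A ∈ gProj m S ∧ ⇑H = stdFun m 0 A u) ∨
   (∃ φ₃ : Matrix (Fin m) (Fin m) ℝ →ₗ[ℝ] ℝ,
      (∃ A ∈ gProj m S, φ₃ A ≠ 0) ∧
      (∀ A B : Matrix (Fin m) (Fin m) ℝ, A ∈ gProj m S →
        B ∈ gProj m S → φ₃ (A * B - B * A) = 0) ∧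
      (∀ H : LSp m →ₗ[ℝ] LSp m, H ∈ S ↔
        ∃ (A : Matrix (Fin m) (Fin m) ℝ) (u : Fin m → ℝ),
          A ∈ gProj m S ∧ ⇑H = stdFun m (φ₃ A) A u)) ∨
   (∃ ℓ : ℕ, 0 < ℓ ∧ ℓ < m ∧
      (∀ A ∈ gProj m S, ∀ i j : Fin m,
        (ℓ ≤ (i : ℕ) ∨ ℓ ≤ (j : ℕ)) → A i j = 0) ∧
      ∃ ψ : Matrix (Fin m) (Fin m) ℝ →ₗ[ℝ] (Fin m → ℝ),
        (∀ A ∈ gProj m S, ∀ i : Fin m, (i : ℕ) < ℓ → ψ A i = 0) ∧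
        (∀ z : Fin m → ℝ, (∀ i : Fin m, (i : ℕ) < ℓ → z i = 0) →
          ∃ A ∈ gProj m S, ψ A = z) ∧
        (∀ A B : Matrix (Fin m) (Fin m) ℝ, A ∈ gProj m S →
          B ∈ gProj m S → ψ (A * B - B * A) = 0) ∧
        (∀ H : LSp m →ₗ[ℝ] LSp m, H ∈ S ↔
          ∃ (A : Matrix (Fin m) (Fin m) ℝ) (u : Fin m → ℝ),
            A ∈ gProj m S ∧
            (∀ i : Fin m, ℓ ≤ (i : ℕ) → u i = 0) ∧
            ⇑H = stdFun m 0 A (u + ψ A))))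

namespace IsNormalized

variable {h : Submodule ℝ (LSp m →ₗ[ℝ] LSp m)} {ℓ : ℕ}

theorem isStandardType_of_eq_top (hh : IsNormalized h ℓ) (htop : translationPart h = ⊤) :
    IsStandardType m h := by
  have hfill : ∀ {a A u} v, stdLin m (a, A, u) ∈ h → stdLin m (a, A, v) ∈ h := fun {a A u} v hX => by
    have := IsStabilizing.stdLin_add_mem hX (htop ▸ Submodule.mem_top : v - u ∈ translationPart h)
    rwa [add_sub_cancel] at this
  refine ⟨fun H hH => ?_, ?_⟩
  · simpa only [coe_eq_stdFun_iff] using hh.exists_std H hH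
  simp only [coe_eq_stdFun_iff, SetLike.mem_coe, mem_gProj]
  by_cases h1 : stdLin m (1, 0, 0) ∈ h
  · left
    intro H
    constructor
    · intro hH
      obtain ⟨a, A, u, -, rfl⟩ := hh.exists_std H hH
      exact ⟨a, A, u, ⟨a, u, hH⟩, rfl⟩
    · rintro ⟨a, A, u, ⟨a', u', hX⟩, rfl⟩
      have : ((a, A, u) : ℝ × Matrix (Fin m) (Fin m) ℝ × (Fin m → ℝ))
          = (a', A, u) + (a - a') • (1, 0, 0) := by simp
      rw [this, map_add, map_smul]
      exact h.add_mem (hfill u hX) (h.smul_mem _ h1)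
  right
  let S : Submodule ℝ (Matrix (Fin m) (Fin m) ℝ × ℝ) := h.comap
    (stdLin m ∘ₗ (LinearMap.snd ℝ _ _).prod ((LinearMap.fst ℝ _ _).prod 0))
  have hS : ∀ A a, (A, a) ∈ S ↔ stdLin m (a, A, 0) ∈ h := fun _ _ => Iff.rfl
  obtain ⟨f, hf⟩ := exists_linearMap_of_graph S (fun a ha => by
    rw [hS] at ha
    by_contra ha0
    apply h1
    have := h.smul_mem a⁻¹ ha
    rw [← map_smul] at this
    simpa [ha0] using this)
  have hf' : ∀ {a A u}, stdLin m (a, A, u) ∈ h → f A = a := fun {a A u} hX => hf _ _ (hfill 0 hX)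
  have hmain : ∀ H : LSp m →ₗ[ℝ] LSp m, H ∈ h ↔ ∃ (A : Matrix (Fin m) (Fin m) ℝ) (u : Fin m → ℝ),
      (∃ a u, stdLin m (a, A, u) ∈ h) ∧ H = stdLin m (f A, A, u) := by
    intro H
    constructor
    · intro hH
      obtain ⟨a, A, u, -, rfl⟩ := hh.exists_std H hH
      exact ⟨A, u, ⟨a, u, hH⟩, by rw [hf' hH]⟩
    · rintro ⟨A, u, ⟨a, u', hX⟩, rfl⟩
      rw [hf' hX]
      exact hfill u hX
  by_cases hex : ∃ A, (∃ a u, stdLin m (a, A, u) ∈ h) ∧ f A ≠ 0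
  · right; left
    refine ⟨f, hex, ?_, hmain⟩
    rintro A B ⟨a, u, hX⟩ ⟨b, v, hY⟩
    exact hf' (hh.commutator_mem hX hY)
  · left
    push Not at hex
    intro H
    rw [hmain]
    refine exists_congr fun A => exists_congr fun u => and_congr_right fun hA => ?_
    rw [hex A hA]

theorem isStandardType_of_ne_top (hm : 1 ≤ m) (hh : IsNormalized h ℓ)
    (htop : translationPart h ≠ ⊤) : IsStandardType m h := by
  have hskew : ∀ {a A u}, stdLin m (a, A, u) ∈ h → ∀ i j, A i j = - A j i :=
    fun {a A u} hX i j => congrFun (congrFun (hh.transpose_eq hX) j) i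
  have ha0 : ∀ {a A u}, stdLin m (a, A, u) ∈ h → a = 0 := fun {a A u} hX => by
    by_contra ha
    apply htop
    rw [← hh.sup_eq_top, left_eq_sup]
    intro w hw
    have h1 : A *ᵥ w ⬝ᵥ w = 0 := by
      have h2 : A *ᵥ w ⬝ᵥ w = -(A *ᵥ w ⬝ᵥ w) := by
        conv_lhs => rw [dotProduct_comm, dotProduct_mulVec, ← mulVec_transpose,
          hh.transpose_eq hX, neg_mulVec, neg_dotProduct]
      linarith
    rw [eq_neg_of_add_eq_zero_left (hw a A u hX), neg_dotProduct, smul_dotProduct, smul_eq_mul,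
      neg_eq_zero, mul_eq_zero, or_iff_right ha, dotProduct_self_eq_zero] at h1
    rw [h1]
    exact Submodule.zero_mem _
  have hlt : ℓ < m := by
    refine lt_of_le_of_ne hh.le fun hℓ => htop (Submodule.eq_top_iff'.2 fun z => ?_)
    exact (hh.mem_iff z).2 fun i hi => absurd i.2 (by omega)
  have hkill : ∀ {a A u}, stdLin m (a, A, u) ∈ h → ∀ x : Fin m → ℝ,
      (∀ i : Fin m, (i : ℕ) < ℓ → x i = 0) → A *ᵥ x = 0 := fun {a A u} hX x hx => by
    have hxT : A *ᵥ x ∈ translationPart h := by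
      obtain ⟨t, ht, k, hk, rfl⟩ := Submodule.mem_sup.1
        (hh.sup_eq_top ▸ Submodule.mem_top : x ∈ translationPart h ⊔ invariantPart h)
      have hAk := hk _ _ _ hX
      rw [ha0 hX, zero_smul, add_zero] at hAk
      rw [mulVec_add, hAk, add_zero]
      exact hh.mulVec_mem_translationPart hX ht
    ext i
    rcases lt_or_ge (i : ℕ) ℓ with hi | hi
    · exact hh.mulVec_apply_eq_zero hh.mem_iff hX hx hi
    · exact (hh.mem_iff _).1 hxT i hi
  have hentry : ∀ {a A u}, stdLin m (a, A, u) ∈ h → ∀ i j : Fin m, ℓ ≤ (j : ℕ) → A i j = 0 :=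
    fun {a A u} hX i j hj => by
      have := congrFun (hkill hX (Pi.single j 1) fun k hk => by
        rw [Pi.single_eq_of_ne]
        rintro rfl
        omega) i
      simpa using this
  let S : Submodule ℝ (Matrix (Fin m) (Fin m) ℝ × (Fin m → ℝ)) :=
    { carrier := {X | stdLin m (0, X) ∈ h ∧ ∀ i : Fin m, (i : ℕ) < ℓ → X.2 i = 0}
      add_mem' := fun {X Y} hX hY => ⟨by
        have := h.add_mem hX.1 hY.1
        rw [← map_add] at this
        simpa using this, fun i hi => by simp [hX.2 i hi, hY.2 i hi]⟩
      zero_mem' := ⟨by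
        have := h.zero_mem
        rwa [← map_zero (stdLin m)] at this, fun i _ => rfl⟩
      smul_mem' := fun c X hX => ⟨by
        have := h.smul_mem c hX.1
        rw [← map_smul] at this
        simpa using this, fun i hi => by simp [hX.2 i hi]⟩ }
  have hStail : ∀ {a A u}, stdLin m (a, A, u) ∈ h → (A, tailPart ℓ u) ∈ S := fun {a A u} hX => by
    have := IsStabilizing.tailPart_mem hh.mem_iff hX
    rw [ha0 hX] at this
    exact ⟨this, fun i hi => tailPart_apply_of_lt u hi⟩
  obtain ⟨ψ, hψ⟩ := exists_linearMap_of_graph S (fun w hw => by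
    ext i
    rcases lt_or_ge (i : ℕ) ℓ with hi | hi
    · exact hw.2 i hi
    · exact (hh.mem_iff w).1 hw.1 i hi)
  have hψtail : ∀ {a A u}, stdLin m (a, A, u) ∈ h → ψ A = tailPart ℓ u :=
    fun hX => hψ _ _ (hStail hX)
  have hsurj : ∀ z : Fin m → ℝ, (∀ i : Fin m, (i : ℕ) < ℓ → z i = 0) →
      ∃ A, (∃ a u, stdLin m (a, A, u) ∈ h) ∧ ψ A = z := fun z hz => by
    have hspan : S.map (LinearMap.snd ℝ _ _) ⊔ translationPart h = ⊤ := by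
      refine eq_top_of_dotPerp_eq_bot (hh.eq_bot_of_invariant fun a A u hX x hx => ?_)
      have hxE : ∀ i : Fin m, (i : ℕ) < ℓ → x i = 0 := fun i hi => by
        have := hx (Pi.single i 1) (Submodule.mem_sup_right ((hh.mem_iff _).2 fun k hk => by
          rw [Pi.single_eq_of_ne]
          rintro rfl
          omega))
        simpa using this
      refine ⟨hx u ?_, by rw [hkill hX x hxE]; exact Submodule.zero_mem _⟩
      rw [← add_sub_cancel (tailPart ℓ u) u]
      exact Submodule.add_mem_sup ⟨_, hStail hX, rfl⟩ (IsStabilizing.sub_tailPart_mem hh.mem_iff u)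
    obtain ⟨_, ⟨⟨A, w⟩, hw, rfl⟩, t, ht, hwt⟩ := Submodule.mem_sup.1
      (hspan ▸ Submodule.mem_top : z ∈ S.map (LinearMap.snd ℝ _ _) ⊔ translationPart h)
    refine ⟨A, ⟨0, w, hw.1⟩, ?_⟩
    rw [hψ A w hw, ← hwt, LinearMap.snd_apply, left_eq_add]
    ext i
    rcases lt_or_ge (i : ℕ) ℓ with hi | hi
    · have h1 := congrFun hwt i
      have h2 := hw.2 i hi
      simp only at h2
      simpa [hz i hi, h2] using h1
    · exact (hh.mem_iff t).1 ht i hi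
  refine ⟨fun H hH => ?_, ?_⟩
  · simpa only [coe_eq_stdFun_iff] using hh.exists_std H hH
  simp only [coe_eq_stdFun_iff, SetLike.mem_coe, mem_gProj]
  right; right; right
  refine ⟨ℓ, ?_, hlt, ?_, ψ, ?_, hsurj, ?_, fun H => ⟨fun hH => ?_, ?_⟩⟩
  · by_contra hℓ
    obtain rfl : ℓ = 0 := by omega
    obtain ⟨A, ⟨a, u, hX⟩, hA⟩ := hsurj (fun _ => 1) fun i hi => absurd hi (Nat.not_lt_zero _)
    have : A = 0 := by
      ext i j
      exact hentry hX i j (Nat.zero_le _)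
    rw [this, map_zero] at hA
    exact zero_ne_one (congrFun hA ⟨0, hm⟩)
  · rintro A ⟨a, u, hX⟩ i j (hi | hj)
    · rw [hskew hX, hentry hX j i hi, neg_zero]
    · exact hentry hX i j hj
  · rintro A ⟨a, u, hX⟩ i hi
    rw [hψtail hX, tailPart_apply_of_lt u hi]
  · rintro A B ⟨a, u, hX⟩ ⟨b, v, hY⟩
    have h1 := hStail hX
    have h2 := hStail hY
    have h3 := hh.commutator_mem h1.1 h2.1
    simp only [zero_smul, add_zero] at h3
    rw [hkill hX _ h2.2, hkill hY _ h1.2, sub_zero] at h3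
    exact hψ _ _ ⟨h3, fun _ _ => rfl⟩
  · obtain ⟨a, A, u, -, rfl⟩ := hh.exists_std H hH
    refine ⟨A, u - tailPart ℓ u, ⟨a, u, hH⟩, fun i hi => ?_, ?_⟩
    · rw [Pi.sub_apply, tailPart_apply_of_le u hi, sub_self]
    · rw [hψtail hH, sub_add_cancel, ha0 hH]
  · rintro ⟨A, u, ⟨a, v, hX⟩, hu, rfl⟩
    rw [hψtail hX, add_comm]
    exact IsStabilizing.stdLin_add_mem (hStail hX).1 ((hh.mem_iff u).2 hu)

end IsNormalized

end Classification

theorem berard_bergery_ikemakhen_classification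
    {m : ℕ} (hm : 1 ≤ m)
    (hsub : Submodule ℝ (LSp m →ₗ[ℝ] LSp m))
    -- 𝔥 is a Lie subalgebra of 𝔰𝔬(1, m+1)
    (hlie : ∀ H ∈ hsub, ∀ K ∈ hsub, H * K - K * H ∈ hsub)
    (hskew : ∀ H ∈ hsub, ∀ x y : LSp m, LForm (H x) y = - LForm x (H y))
    -- 𝔥 acts non-irreducibly …
    (hnonirr : ∃ W : Submodule ℝ (LSp m), W ≠ ⊥ ∧ W ≠ ⊤ ∧
      ∀ H ∈ hsub, ∀ x ∈ W, H x ∈ W)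
    -- … but weakly irreducibly: every proper nonzero invariant subspace is degenerate
    (hweak : ∀ W : Submodule ℝ (LSp m), (∀ H ∈ hsub, ∀ x ∈ W, H x ∈ W) →
      W ≠ ⊥ → W ≠ ⊤ → ∃ x ∈ W, x ≠ 0 ∧ ∀ y ∈ W, LForm x y = 0) :
    -- then, after conjugation by an isometry of the form, …
    ∃ φ : LSp m ≃ₗ[ℝ] LSp m,
      (∀ x y : LSp m, LForm (φ x) (φ y) = LForm x y) ∧
      -- 𝔥 ⊆ (ℝ ⊕ 𝔰𝔬(m)) ⋉ ℝ^m
      (∀ H ∈ conjSet m φ hsub, ∃ (a : ℝ) (A : Matrix (Fin m) (Fin m) ℝ)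
        (u : Fin m → ℝ), Aᵀ = -A ∧ ⇑H = stdFun m a A u) ∧
      -- and 𝔥 is of one of the four types, where 𝔤 := pr_{𝔰𝔬(m)}(𝔥):
      ((∀ H : LSp m →ₗ[ℝ] LSp m, H ∈ conjSet m φ hsub ↔
          ∃ (a : ℝ) (A : Matrix (Fin m) (Fin m) ℝ) (u : Fin m → ℝ),
            A ∈ gProj m (conjSet m φ hsub) ∧ ⇑H = stdFun m a A u) ∨
       (∀ H : LSp m →ₗ[ℝ] LSp m, H ∈ conjSet m φ hsub ↔
          ∃ (A : Matrix (Fin m) (Fin m) ℝ) (u : Fin m → ℝ),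
            A ∈ gProj m (conjSet m φ hsub) ∧ ⇑H = stdFun m 0 A u) ∨
       (∃ φ₃ : Matrix (Fin m) (Fin m) ℝ →ₗ[ℝ] ℝ,
          (∃ A ∈ gProj m (conjSet m φ hsub), φ₃ A ≠ 0) ∧
          (∀ A B : Matrix (Fin m) (Fin m) ℝ, A ∈ gProj m (conjSet m φ hsub) →
            B ∈ gProj m (conjSet m φ hsub) → φ₃ (A * B - B * A) = 0) ∧
          (∀ H : LSp m →ₗ[ℝ] LSp m, H ∈ conjSet m φ hsub ↔
            ∃ (A : Matrix (Fin m) (Fin m) ℝ) (u : Fin m → ℝ),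
              A ∈ gProj m (conjSet m φ hsub) ∧ ⇑H = stdFun m (φ₃ A) A u)) ∨
       (∃ ℓ : ℕ, 0 < ℓ ∧ ℓ < m ∧
          -- 𝔤 ⊆ 𝔰𝔬(ℓ), where ℝ^ℓ is spanned by the first ℓ coordinates
          (∀ A ∈ gProj m (conjSet m φ hsub), ∀ i j : Fin m,
            (ℓ ≤ (i : ℕ) ∨ ℓ ≤ (j : ℕ)) → A i j = 0) ∧
          ∃ ψ : Matrix (Fin m) (Fin m) ℝ →ₗ[ℝ] (Fin m → ℝ),
            -- ψ takes values in ℝ^{m-ℓ}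
            (∀ A ∈ gProj m (conjSet m φ hsub), ∀ i : Fin m, (i : ℕ) < ℓ → ψ A i = 0) ∧
            -- ψ : 𝔤 → ℝ^{m-ℓ} is surjective
            (∀ z : Fin m → ℝ, (∀ i : Fin m, (i : ℕ) < ℓ → z i = 0) →
              ∃ A ∈ gProj m (conjSet m φ hsub), ψ A = z) ∧
            -- ψ vanishes on [𝔤,𝔤]
            (∀ A B : Matrix (Fin m) (Fin m) ℝ, A ∈ gProj m (conjSet m φ hsub) →
              B ∈ gProj m (conjSet m φ hsub) → ψ (A * B - B * A) = 0) ∧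
            (∀ H : LSp m →ₗ[ℝ] LSp m, H ∈ conjSet m φ hsub ↔
              ∃ (A : Matrix (Fin m) (Fin m) ℝ) (u : Fin m → ℝ),
                A ∈ gProj m (conjSet m φ hsub) ∧
                (∀ i : Fin m, ℓ ≤ (i : ℕ) → u i = 0) ∧
                ⇑H = stdFun m 0 A (u + ψ A)))) := by
  have hh : IsWeaklyIrreducible hsub := ⟨hlie, hskew, hweak⟩
  obtain ⟨ψ, hψ, hstd⟩ := hh.exists_conj_stabilizer hnonirr
  obtain ⟨φ, hφ, ℓ, hnorm⟩ := IsStabilizing.exists_isNormalized ⟨hh.conj hψ, hstd⟩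
  rw [conjSubmodule_conjSubmodule] at hnorm
  refine ⟨φ.trans ψ, fun x y => ?_, ?_⟩
  · rw [LinearEquiv.trans_apply, LinearEquiv.trans_apply, hψ, hφ]
  · rw [conjSet_eq_coe_conjSubmodule]
    by_cases htop : translationPart (conjSubmodule (φ.trans ψ) hsub) = ⊤
    · exact hnorm.isStandardType_of_eq_top htop
    · exact hnorm.isStandardType_of_ne_top hm htop
end
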